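/- arXiv:2101.05686 — 5 statements merged into one kernel-verified Lean document; each statement's English description precedes it below -/
import Mathlib

section
/- Let Λ be a quantum operation on d×d complex matrices with Kraus operators A_1,…,A_K and E = Σ_k A_kᴴ A_k ≤ I. Suppose Λ' is a completely positive map given by Kraus operators B_1,…,B_L such that Σ_l B_lᴴ B_l = I − E (i.e., Λ + Λ' is trace preserving). Then there exist finitely many d×d matrices C_1,…,C_M with Σ_m C_mᴴ C_m = I such that for every d×d matrix X, Σ_l B_l X B_lᴴ = Σ_m C_m (√(I−E) X √(I−E)) C_mᴴ, where √(I−E) is the positive semidefinite square root of I − E. In other words, every extension of Λ to a channel is a channel composed with the minimal extension Λ'_min(X) = √(I−E) X √(I−E). -/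
open Matrix ComplexOrder MatrixOrder

/-- A Hermitian matrix has a Hermitian generalized inverse that commutes with it. -/
theorem Matrix.IsHermitian.exists_commuting_pseudoinverse {n : Type*} [Fintype n] [DecidableEq n]
    {S : Matrix n n ℂ} (hS : S.IsHermitian) :
    ∃ T : Matrix n n ℂ, T.IsHermitian ∧ S * T = T * S ∧ S * T * S = S := by
  have hS' : IsSelfAdjoint S := hS
  have hcont (f : ℝ → ℝ) : ContinuousOn f (spectrum ℝ S) :=
    (Matrix.finite_real_spectrum (A := S)).continuousOn f
  have hid : cfc (fun x : ℝ => x) S = S := cfc_id' ℝ S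
  have hmul (f g : ℝ → ℝ) : cfc f S * cfc g S = cfc (fun x => f x * g x) S :=
    (cfc_mul f g S (hcont f) (hcont g)).symm
  refine ⟨cfc (fun x : ℝ => x⁻¹) S, cfc_predicate (R := ℝ) _ S, ?_, ?_⟩
  · nth_rewrite 1 [← hid]
    nth_rewrite 4 [← hid]
    rw [hmul, hmul]
    simp only [mul_comm]
  · calc S * cfc (fun x : ℝ => x⁻¹) S * S
        = cfc (fun x : ℝ => x) S * cfc (fun x : ℝ => x⁻¹) S * cfc (fun x : ℝ => x) S := by
          rw [hid]
      _ = cfc (fun x : ℝ => x) S := by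
          rw [hmul, hmul]
          simp only [mul_inv_mul_cancel]
      _ = S := hid

/-- If a sum of Gram matrices `(B l)ᴴ * B l` is annihilated by `Q` on the right, then so is
every `B l`. -/
theorem Matrix.mul_eq_zero_of_sum_conjTranspose_mul_self_mul_eq_zero {ι m n : Type*} [Fintype ι]
    [Fintype m] [Fintype n] (B : ι → Matrix m n ℂ) (Q : Matrix n n ℂ)
    (h : (∑ l, (B l)ᴴ * B l) * Q = 0) (l : ι) : B l * Q = 0 := by
  have hsum : ∑ l, (B l * Q)ᴴ * (B l * Q) = 0 := by
    calc ∑ l, (B l * Q)ᴴ * (B l * Q) = Qᴴ * ((∑ l, (B l)ᴴ * B l) * Q) := by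
          simp only [conjTranspose_mul, Finset.sum_mul, Finset.mul_sum, Matrix.mul_assoc]
      _ = 0 := by rw [h, Matrix.mul_zero]
  have hzero := (Finset.sum_eq_zero_iff_of_nonneg
    (fun l _ => (posSemidef_conjTranspose_mul_self (B l * Q)).nonneg)).1 hsum l (Finset.mem_univ l)
  exact conjTranspose_mul_self_eq_zero.1 hzero

/-- every extension of a quantum operation Λ to a trace preserving map is a
channel composed with the minimal extension Λ'_min(X) = √(I−E) X √(I−E). -/
theorem extension_eq_channel_comp_minimal_extension (d K L : ℕ)
    (A : Fin K → Matrix (Fin d) (Fin d) ℂ)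
    (B : Fin L → Matrix (Fin d) (Fin d) ℂ)
    (E : Matrix (Fin d) (Fin d) ℂ)
    (hE : E = ∑ k, (A k)ᴴ * A k)
    (hE1 : (1 - E).PosSemidef)
    (hB : ∑ l, (B l)ᴴ * B l = 1 - E) :
    ∃ (M : ℕ) (C : Fin M → Matrix (Fin d) (Fin d) ℂ),
      ∑ m, (C m)ᴴ * C m = 1 ∧
      ∀ X : Matrix (Fin d) (Fin d) ℂ,
        ∑ l, B l * X * (B l)ᴴ =
          ∑ m, C m * (CFC.sqrt (1 - E) * X * CFC.sqrt (1 - E)) * (C m)ᴴ := by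
  have hSS : CFC.sqrt (1 - E) * CFC.sqrt (1 - E) = 1 - E :=
    CFC.sqrt_mul_sqrt_self _ hE1.nonneg
  have hSh : (CFC.sqrt (1 - E)).IsHermitian :=
    (nonneg_iff_posSemidef.1 (CFC.sqrt_nonneg (1 - E))).isHermitian
  generalize CFC.sqrt (1 - E) = S at hSS hSh ⊢
  obtain ⟨T, hT, hcomm, hSTS⟩ := hSh.exists_commuting_pseudoinverse
  have hPh : (S * T)ᴴ = S * T := by
    rw [conjTranspose_mul, hT.eq, hSh.eq, hcomm]
  have hPP : S * T * (S * T) = S * T := by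
    rw [← Matrix.mul_assoc, hSTS]
  have hQS : (1 - S * T) * S = 0 := by
    rw [Matrix.sub_mul, Matrix.one_mul, hSTS, sub_self]
  have hSQ : S * (1 - S * T) = 0 := by
    rw [Matrix.mul_sub, Matrix.mul_one, hcomm, ← Matrix.mul_assoc, hSTS, sub_self]
  have hBQ (l : Fin L) : B l * (1 - S * T) = 0 := by
    refine mul_eq_zero_of_sum_conjTranspose_mul_self_mul_eq_zero B _ ?_ l
    rw [hB, ← hSS, Matrix.mul_assoc, hSQ, Matrix.mul_zero]
  have hBTS (l : Fin L) : B l * T * S = B l := by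
    have h := hBQ l
    rw [Matrix.mul_sub, Matrix.mul_one, sub_eq_zero, hcomm, ← Matrix.mul_assoc] at h
    exact h.symm
  refine ⟨L + 1, Fin.cons (1 - S * T) (fun l => B l * T), ?_, fun X => ?_⟩
  · have hTPT : ∑ l, (B l * T)ᴴ * (B l * T) = S * T := by
      calc ∑ l, (B l * T)ᴴ * (B l * T) = T * (∑ l, (B l)ᴴ * B l) * T := by
            simp only [conjTranspose_mul, hT.eq, Finset.sum_mul, Finset.mul_sum, Matrix.mul_assoc]
        _ = (T * S) * (S * T) := by
            rw [hB, ← hSS]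
            simp only [Matrix.mul_assoc]
        _ = S * T := by rw [← hcomm, hPP]
    simp only [Fin.sum_univ_succ, Fin.cons_zero, Fin.cons_succ, hTPT, conjTranspose_sub,
      conjTranspose_one, hPh]
    rw [Matrix.mul_sub, Matrix.sub_mul _ _ (S * T), hPP, Matrix.mul_one, Matrix.one_mul, sub_self,
      sub_zero, sub_add_cancel]
  · have hterm (l : Fin L) : B l * T * (S * X * S) * (B l * T)ᴴ = B l * X * (B l)ᴴ := by
      calc B l * T * (S * X * S) * (B l * T)ᴴ = (B l * T * S) * X * (B l * T * S)ᴴ := by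
            rw [conjTranspose_mul (B l * T) S, hSh.eq]
            simp only [Matrix.mul_assoc]
        _ = B l * X * (B l)ᴴ := by rw [hBTS]
    have hzero : (1 - S * T) * (S * X * S) = 0 := by
      rw [← Matrix.mul_assoc, ← Matrix.mul_assoc, hQS, Matrix.zero_mul, Matrix.zero_mul]
    simp only [Fin.sum_univ_succ, Fin.cons_zero, Fin.cons_succ, hterm, hzero, Matrix.zero_mul,
      zero_add]
end

section
/- Let Λ be a quantum operation on d×d complex matrices with Kraus operators A_1,…,A_K such that E = Σ_k A_kᴴ A_k is positive definite and E ≤ I. Then tr(Λ(ρ)) > 0 for every density matrix ρ, and the set of normalized outputs { Λ(ρ)/tr(Λ(ρ)) : ρ a d×d density matrix } equals the image { Φ_Λ(ρ) : ρ a d×d density matrix } of the quantum channel Φ_Λ defined by Φ_Λ(ρ) = Λ(E^{−1/2} ρ E^{−1/2}), where E^{−1/2} is the inverse of the positive definite square root of E. -/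
open Matrix ComplexOrder MatrixOrder

/-- Conjugating a density matrix by an invertible Hermitian matrix gives positive trace. -/
lemma trace_conj_pos {n : Type*} [Fintype n] [DecidableEq n] {S ρ : Matrix n n ℂ}
    (hS : S.IsHermitian) (hu : IsUnit S.det) (hρ : ρ.PosSemidef) (ht : ρ.trace = 1) :
    0 < (S * ρ * S).trace := by
  have hp : (S * ρ * S).PosSemidef := by
    simpa only [hS.eq] using hρ.mul_mul_conjTranspose_same S
  refine lt_of_le_of_ne hp.trace_nonneg fun h => ?_
  have h0 := hp.trace_eq_zero_iff.mp h.symm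
  have hz : ρ = 0 := by
    calc ρ = S⁻¹ * (S * ρ * S) * S⁻¹ := by
          rw [mul_assoc S, nonsing_inv_mul_cancel_left _ _ hu, mul_nonsing_inv_cancel_right _ _ hu]
      _ = 0 := by rw [h0]; simp
  simp [hz] at ht

/-- The trace of a quantum operation's output, with the Kraus sum written as a square. -/
lemma trace_kraus_eq_trace_conj {n ι : Type*} [Fintype n] [Fintype ι]
    {A : ι → Matrix n n ℂ} {S : Matrix n n ℂ} (hS : S * S = ∑ k, (A k)ᴴ * A k)
    (X : Matrix n n ℂ) :
    (∑ k, A k * X * (A k)ᴴ).trace = (S * X * S).trace := by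
  rw [trace_mul_comm (S * X), ← mul_assoc, hS, Finset.sum_mul, trace_sum, trace_sum]
  refine Finset.sum_congr rfl fun k _ => ?_
  rw [trace_mul_comm, ← mul_assoc]

/-- A quantum operation is homogeneous. -/
lemma kraus_smul {n ι : Type*} [Fintype n] [Fintype ι] (A : ι → Matrix n n ℂ) (c : ℂ)
    (X : Matrix n n ℂ) :
    ∑ k, A k * (c • X) * (A k)ᴴ = c • ∑ k, A k * X * (A k)ᴴ := by
  simp only [mul_smul_comm, smul_mul_assoc, Finset.smul_sum]

/-- for a quantum operation Λ with E = Σ_k A_kᴴ A_k positive definite, the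
detection probability tr(Λ ρ) is positive on density matrices, and the set of normalized
outputs Λ(ρ)/tr(Λ ρ) coincides with the image of the channel Φ_Λ(ρ) = Λ(E^{-1/2} ρ E^{-1/2}). -/
theorem normalized_image_eq_channel_image (d K : ℕ)
    (A : Fin K → Matrix (Fin d) (Fin d) ℂ)
    (E : Matrix (Fin d) (Fin d) ℂ)
    (hE : E = ∑ k, (A k)ᴴ * A k)
    (hEpd : E.PosDef)
    (hE1 : (1 - E).PosSemidef) :
    (∀ ρ : Matrix (Fin d) (Fin d) ℂ, ρ.PosSemidef → ρ.trace = 1 →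
        0 < ((∑ k, A k * ρ * (A k)ᴴ).trace).re) ∧
    {σ : Matrix (Fin d) (Fin d) ℂ | ∃ ρ : Matrix (Fin d) (Fin d) ℂ,
        ρ.PosSemidef ∧ ρ.trace = 1 ∧
        σ = ((∑ k, A k * ρ * (A k)ᴴ).trace)⁻¹ • ∑ k, A k * ρ * (A k)ᴴ}
      = {σ : Matrix (Fin d) (Fin d) ℂ | ∃ ρ : Matrix (Fin d) (Fin d) ℂ,
        ρ.PosSemidef ∧ ρ.trace = 1 ∧
        σ = ∑ k, A k * ((CFC.sqrt E)⁻¹ * ρ * (CFC.sqrt E)⁻¹) * (A k)ᴴ} := by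
  have hSS : CFC.sqrt E * CFC.sqrt E = E := CFC.sqrt_mul_sqrt_self E hEpd.posSemidef.nonneg
  have hSh : (CFC.sqrt E).IsHermitian := (nonneg_iff_posSemidef.mp (CFC.sqrt_nonneg E)).isHermitian
  have hu : IsUnit (CFC.sqrt E).det := by
    refine isUnit_of_mul_isUnit_left (y := (CFC.sqrt E).det) ?_
    rw [← det_mul, hSS]
    exact (isUnit_iff_isUnit_det E).mp hEpd.isUnit
  generalize CFC.sqrt E = S at hSS hSh hu ⊢
  have htr := trace_kraus_eq_trace_conj (hSS.trans hE)
  refine ⟨fun ρ hρ ht => ?_, ?_⟩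
  · rw [htr]
    exact (Complex.pos_iff.mp (trace_conj_pos hSh hu hρ ht)).1
  ext σ
  constructor
  · rintro ⟨ρ, hρ, ht, rfl⟩
    have hpos := trace_conj_pos hSh hu hρ ht
    refine ⟨(S * ρ * S).trace⁻¹ • (S * ρ * S), ?_, ?_, ?_⟩
    · refine PosSemidef.smul ?_ (inv_nonneg.mpr hpos.le)
      simpa only [hSh.eq] using hρ.mul_mul_conjTranspose_same S
    · rw [trace_smul, smul_eq_mul, inv_mul_cancel₀ hpos.ne']
    · rw [htr, mul_smul_comm, smul_mul_assoc, kraus_smul, mul_assoc S,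
        nonsing_inv_mul_cancel_left _ _ hu, mul_nonsing_inv_cancel_right _ _ hu]
  · rintro ⟨ρ, hρ, ht, rfl⟩
    have hpos := trace_conj_pos hSh.inv ((isUnit_nonsing_inv_det_iff).mpr hu) hρ ht
    refine ⟨(S⁻¹ * ρ * S⁻¹).trace⁻¹ • (S⁻¹ * ρ * S⁻¹), ?_, ?_, ?_⟩
    · refine PosSemidef.smul ?_ (inv_nonneg.mpr hpos.le)
      simpa only [hSh.inv.eq] using hρ.mul_mul_conjTranspose_same S⁻¹
    · rw [trace_smul, smul_eq_mul, inv_mul_cancel₀ hpos.ne']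
    · rw [mul_assoc S⁻¹] at hpos ⊢
      rw [htr, mul_smul_comm, smul_mul_assoc, kraus_smul,
        mul_nonsing_inv_cancel_left _ _ hu, nonsing_inv_mul_cancel_right _ _ hu,
        trace_smul, ht, smul_eq_mul, mul_one, inv_inv, smul_smul, mul_inv_cancel₀ hpos.ne',
        one_smul]
end

section
/- Let Λ be a quantum operation on d×d complex matrices with Kraus operators A_1,…,A_K such that E = Σ_k A_kᴴ A_k is positive definite and E ≤ I, and let p_min and p_max be the smallest and largest eigenvalues of E. Let Φ_Λ be the channel Φ_Λ(ρ) = Λ(E^{−1/2} ρ E^{−1/2}) and let Γ_Λ be the generalized erasure channel of Λ. Then p_min · C_χ(Φ_Λ) ≤ C_χ(Γ_Λ) ≤ p_max · C_χ(Φ_Λ) + F(p_min, p_max). -/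
open Matrix ComplexOrder MatrixOrder

/-- The von Neumann entropy S(ρ) = Σ_i −λ_i log λ_i over the eigenvalues of a Hermitian
matrix (and 0 on non-Hermitian matrices). Natural logarithm, 0 log 0 = 0. -/
noncomputable def vnEnt {n : Type*} [Fintype n] [DecidableEq n] (ρ : Matrix n n ℂ) : ℝ :=
  if h : ρ.IsHermitian then ∑ i, -(h.eigenvalues i * Real.log (h.eigenvalues i)) else 0

/-- The Holevo capacity of a map Ψ on matrices: the supremum over finite ensembles of
density matrices of S(Ψ(Σ π_i ρ_i)) − Σ π_i S(Ψ(ρ_i)). -/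
noncomputable def holevoCap {n m : Type*} [Fintype n] [DecidableEq n] [Fintype m] [DecidableEq m]
    (Ψ : Matrix n n ℂ → Matrix m m ℂ) : ℝ :=
  sSup {x : ℝ | ∃ (N : ℕ) (π : Fin N → ℝ) (ρ : Fin N → Matrix n n ℂ),
    (∀ i, 0 ≤ π i) ∧ (∑ i, π i = 1) ∧ (∀ i, (ρ i).PosSemidef ∧ (ρ i).trace = 1) ∧
    x = vnEnt (Ψ (∑ i, (π i : ℂ) • ρ i)) - ∑ i, π i * vnEnt (Ψ (ρ i))}

/-- The generalized erasure channel of a quantum operation Λ. -/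
noncomputable def gec {n : Type*} [Fintype n] [DecidableEq n]
    (Λ : Matrix n n ℂ → Matrix n n ℂ) (X : Matrix n n ℂ) :
    Matrix (n ⊕ Fin 1) (n ⊕ Fin 1) ℂ :=
  Matrix.fromBlocks (Λ X) 0 0 (Matrix.of fun _ _ => X.trace - (Λ X).trace)

/-- The binary entropy h(x) = −x log x − (1−x) log(1−x) (natural logarithm). -/
noncomputable def binEnt (x : ℝ) : ℝ := -x * Real.log x - (1 - x) * Real.log (1 - x)

/-- F(a,b) = log(1 + exp(−(h(b)−h(a))/(b−a))) − (b·h(a) − a·h(b))/(b−a) for a ≠ b, F(a,a) = 0. -/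
noncomputable def Fbound (a b : ℝ) : ℝ :=
  if a = b then 0 else
    Real.log (1 + Real.exp (-((binEnt b - binEnt a) / (b - a))))
      - (b * binEnt a - a * binEnt b) / (b - a)

/-! ### Entropy of Hermitian matrices -/

/-- The von Neumann entropy may be read off from any real factorisation of the characteristic
polynomial. -/
lemma vnEnt_eq_of_charpoly {n ι : Type*} [Fintype n] [DecidableEq n] [Fintype ι]
    {M : Matrix n n ℂ} (hM : M.IsHermitian) (f : ι → ℝ)
    (hf : M.charpoly = ∏ i, (Polynomial.X - Polynomial.C (f i : ℂ))) :
    vnEnt M = ∑ i, Real.negMulLog (f i) := by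
  have h1 := hM.roots_charpoly_eq_eigenvalues
  rw [hf, Polynomial.roots_prod _ _
    (Finset.prod_ne_zero_iff.mpr fun i _ => Polynomial.X_sub_C_ne_zero _)] at h1
  have h2 := congrArg
    (fun s : Multiset ℂ => (s.map fun z => Real.negMulLog z.re).sum) h1
  simp only [Polynomial.roots_X_sub_C, Multiset.bind_singleton, Multiset.map_map,
    Function.comp_def, Complex.ofReal_re] at h2
  rw [vnEnt, dif_pos hM]
  exact (h2.trans (Finset.sum_congr rfl fun i _ => by simp [Real.negMulLog])).symm

lemma vnEnt_eq_sum_negMulLog {n : Type*} [Fintype n] [DecidableEq n]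
    {M : Matrix n n ℂ} (hM : M.IsHermitian) :
    vnEnt M = ∑ i, Real.negMulLog (hM.eigenvalues i) :=
  vnEnt_eq_of_charpoly hM _ hM.charpoly_eq

lemma charpoly_real_smul {n : Type*} [Fintype n] [DecidableEq n]
    {M : Matrix n n ℂ} (hM : M.IsHermitian) (c : ℝ) :
    ((c : ℂ) • M).charpoly =
      ∏ i, (Polynomial.X - Polynomial.C ((c * hM.eigenvalues i : ℝ) : ℂ)) := by
  conv_lhs => rw [hM.spectral_theorem, Unitary.conjStarAlgAut_apply, ← smul_mul_assoc,
    ← mul_smul_comm, charpoly_mul_comm, ← mul_assoc]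
  rw [Unitary.coe_star_mul_self, one_mul, ← Matrix.diagonal_smul, charpoly_diagonal]
  simp

lemma isHermitian_real_smul {n : Type*} {M : Matrix n n ℂ} (hM : M.IsHermitian) (c : ℝ) :
    ((c : ℂ) • M).IsHermitian := by
  rw [Matrix.IsHermitian, Matrix.conjTranspose_smul, hM.eq]
  simp

lemma sum_eigenvalues_eq_re_trace {n : Type*} [Fintype n] [DecidableEq n]
    {M : Matrix n n ℂ} (hM : M.IsHermitian) :
    ∑ i, hM.eigenvalues i = M.trace.re := by
  rw [hM.trace_eq_sum_eigenvalues]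
  simp

lemma vnEnt_real_smul {n : Type*} [Fintype n] [DecidableEq n]
    {M : Matrix n n ℂ} (hM : M.IsHermitian) (c : ℝ) :
    vnEnt ((c : ℂ) • M) = c * vnEnt M + M.trace.re * Real.negMulLog c := by
  rw [vnEnt_eq_of_charpoly (isHermitian_real_smul hM c) _ (charpoly_real_smul hM c),
    vnEnt_eq_sum_negMulLog hM, ← sum_eigenvalues_eq_re_trace hM, Finset.mul_sum, Finset.sum_mul,
    ← Finset.sum_add_distrib]
  exact Finset.sum_congr rfl fun i _ => by rw [Real.negMulLog_mul]; ring

lemma vnEnt_le_card {n : Type*} [Fintype n] [DecidableEq n]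
    {M : Matrix n n ℂ} (hM : M.PosSemidef) : vnEnt M ≤ Fintype.card n := by
  rw [vnEnt_eq_sum_negMulLog hM.1]
  calc ∑ i, Real.negMulLog (hM.1.eigenvalues i) ≤ ∑ _i : n, (1 : ℝ) :=
        Finset.sum_le_sum fun i _ => by
          linarith [Real.negMulLog_le_one_sub_self (hM.eigenvalues_nonneg i),
            hM.eigenvalues_nonneg i]
    _ = Fintype.card n := by simp

lemma vnEnt_nonneg {n : Type*} [Fintype n] [DecidableEq n]
    {M : Matrix n n ℂ} (hM : M.PosSemidef) (htr : M.trace.re ≤ 1) : 0 ≤ vnEnt M := by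
  rw [vnEnt_eq_sum_negMulLog hM.1]
  refine Finset.sum_nonneg fun i _ => Real.negMulLog_nonneg (hM.eigenvalues_nonneg i) ?_
  rw [← sum_eigenvalues_eq_re_trace hM.1] at htr
  exact (Finset.single_le_sum (fun j _ => hM.eigenvalues_nonneg j) (Finset.mem_univ i)).trans htr

lemma vnEnt_gec {n : Type*} [Fintype n] [DecidableEq n] {Λ : Matrix n n ℂ → Matrix n n ℂ}
    {X : Matrix n n ℂ} (hΛ : (Λ X).IsHermitian) {q : ℝ} (hX : X.trace = 1)
    (hq : (Λ X).trace = q) :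
    vnEnt (gec Λ X) = vnEnt (Λ X) + Real.negMulLog (1 - q) := by
  have hcorner : (Matrix.of fun _ _ => X.trace - (Λ X).trace : Matrix (Fin 1) (Fin 1) ℂ) =
      Matrix.diagonal fun _ => ((1 - q : ℝ) : ℂ) := by
    ext i j
    simp [Subsingleton.elim i j, hX, hq]
  have hherm : (gec Λ X).IsHermitian := by
    rw [gec, hcorner]
    refine Matrix.IsHermitian.fromBlocks hΛ (by simp) ?_
    rw [Matrix.isHermitian_diagonal_iff]
    intro i
    simp [isSelfAdjoint_iff]
  rw [vnEnt_eq_of_charpoly hherm (Sum.elim hΛ.eigenvalues fun _ : Fin 1 => 1 - q),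
    vnEnt_eq_sum_negMulLog hΛ]
  · simp
  · rw [gec, hcorner, Matrix.charpoly_fromBlocks_zero₁₂, Fintype.prod_sum_type,
      hΛ.charpoly_eq, charpoly_diagonal]
    simp

/-! ### Binary entropy -/

lemma binEnt_eq_negMulLog (x : ℝ) : binEnt x = Real.negMulLog x + Real.negMulLog (1 - x) := by
  simp only [binEnt, Real.negMulLog]; ring

lemma concaveOn_binEnt : ConcaveOn ℝ (Set.Icc 0 1) binEnt := by
  have h : binEnt = Real.binEntropy := by
    ext x
    rw [binEnt_eq_negMulLog, Real.binEntropy_eq_negMulLog_add_negMulLog_one_sub]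
  rw [h]
  exact Real.strictConcave_binEntropy.concaveOn

lemma negMulLog_add_mul_log_le {x p : ℝ} (hx : 0 ≤ x) (hp : 0 < p) :
    Real.negMulLog x + x * Real.log p ≤ p - x := by
  rcases hx.eq_or_lt with rfl | hx
  · simpa using hp.le
  have h := mul_le_mul_of_nonneg_left (Real.log_le_sub_one_of_pos (div_pos hp hx)) hx.le
  rw [Real.log_div hp.ne' hx.ne', mul_sub, mul_sub, mul_div_cancel₀ _ hx.ne'] at h
  rw [Real.negMulLog]
  linarith

/-- The Legendre transform bound for the binary entropy. -/
lemma binEnt_le_mul_add_log {x : ℝ} (hx0 : 0 ≤ x) (hx1 : x ≤ 1) (s : ℝ) :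
    binEnt x ≤ s * x + Real.log (1 + Real.exp (-s)) := by
  have he := Real.exp_pos (-s)
  have hL : 0 < 1 + Real.exp (-s) := by positivity
  have h1 := negMulLog_add_mul_log_le hx0 (div_pos he hL)
  have h2 := negMulLog_add_mul_log_le (sub_nonneg.mpr hx1) (one_div_pos.mpr hL)
  have hsum : Real.exp (-s) / (1 + Real.exp (-s)) + 1 / (1 + Real.exp (-s)) = 1 := by
    field_simp; ring
  rw [Real.log_div he.ne' hL.ne', Real.log_exp] at h1
  rw [Real.log_div one_ne_zero hL.ne', Real.log_one] at h2
  rw [binEnt_eq_negMulLog]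
  linarith

lemma chord_le_binEnt {a b x : ℝ} (ha : 0 ≤ a) (hab : a < b) (hb : b ≤ 1) (hx : x ∈ Set.Icc a b) :
    (binEnt b - binEnt a) / (b - a) * x + (b * binEnt a - a * binEnt b) / (b - a) ≤ binEnt x := by
  have hba : 0 < b - a := sub_pos.mpr hab
  have h := concaveOn_binEnt.2 (⟨ha, hab.le.trans hb⟩ : a ∈ Set.Icc (0 : ℝ) 1)
    (⟨ha.trans hab.le, hb⟩ : b ∈ Set.Icc (0 : ℝ) 1)
    (div_nonneg (sub_nonneg.mpr hx.2) hba.le) (div_nonneg (sub_nonneg.mpr hx.1) hba.le)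
    (show (b - x) / (b - a) + (x - a) / (b - a) = 1 by field_simp; ring)
  simp only [smul_eq_mul] at h
  have h1 : (b - x) / (b - a) * a + (x - a) / (b - a) * b = x := by field_simp; ring
  rw [h1] at h
  refine le_trans (le_of_eq ?_) h
  field_simp
  ring

/-- The Jensen gap of the binary entropy on `[a, b]` lies between `0` and `Fbound a b`. -/
lemma binEnt_jensen_gap {N : ℕ} {a b : ℝ} (ha : 0 ≤ a) (hb : b ≤ 1) {μ q : Fin N → ℝ}
    (hμ : ∀ i, 0 ≤ μ i) (hμ1 : ∑ i, μ i = 1) (hq : ∀ i, q i ∈ Set.Icc a b) :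
    0 ≤ binEnt (∑ i, μ i * q i) - ∑ i, μ i * binEnt (q i) ∧
    binEnt (∑ i, μ i * q i) - ∑ i, μ i * binEnt (q i) ≤ Fbound a b := by
  constructor
  · have h := concaveOn_binEnt.le_map_sum (t := Finset.univ) (w := μ) (p := q)
      (fun i _ => hμ i) hμ1 (fun i _ => ⟨ha.trans (hq i).1, (hq i).2.trans hb⟩)
    simpa using h
  · have hmem : ∑ i, μ i * q i ∈ Set.Icc a b := by
      simpa using (convex_Icc a b).sum_mem (fun i _ => hμ i) hμ1 (fun i _ => hq i)
    rcases (hmem.1.trans hmem.2).eq_or_lt with rfl | hab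
    · have hqa : ∀ i, q i = a := fun i => le_antisymm (hq i).2 (hq i).1
      simp [hqa, ← Finset.sum_mul, hμ1, Fbound]
    · rw [Fbound, if_neg hab.ne]
      have h1 := binEnt_le_mul_add_log (ha.trans hmem.1) (hmem.2.trans hb)
        ((binEnt b - binEnt a) / (b - a))
      have h2 : ∑ i, μ i * ((binEnt b - binEnt a) / (b - a) * q i +
          (b * binEnt a - a * binEnt b) / (b - a)) ≤ ∑ i, μ i * binEnt (q i) :=
        Finset.sum_le_sum fun i _ =>
          mul_le_mul_of_nonneg_left (chord_le_binEnt ha hab hb (hq i)) (hμ i)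
      have h3 : ∑ i, μ i * ((binEnt b - binEnt a) / (b - a) * q i +
          (b * binEnt a - a * binEnt b) / (b - a)) =
          (binEnt b - binEnt a) / (b - a) * ∑ i, μ i * q i +
          (b * binEnt a - a * binEnt b) / (b - a) := by
        simp_rw [mul_add, Finset.sum_add_distrib, ← Finset.sum_mul, hμ1, one_mul, Finset.mul_sum]
        congr 1
        exact Finset.sum_congr rfl fun i _ => by ring
      linarith

/-! ### Density matrices -/

/-- A density matrix: positive semidefinite of trace one. -/
def IsDensity {n : Type*} [Fintype n] (ρ : Matrix n n ℂ) : Prop :=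
  ρ.PosSemidef ∧ ρ.trace = 1

lemma posSemidef_real_smul {n : Type*} [Finite n] {M : Matrix n n ℂ} (hM : M.PosSemidef)
    {c : ℝ} (hc : 0 ≤ c) : ((c : ℂ) • M).PosSemidef :=
  hM.smul (by exact_mod_cast hc)

lemma IsDensity.sum {n : Type*} [Fintype n] {N : ℕ} {π : Fin N → ℝ}
    {ρ : Fin N → Matrix n n ℂ} (hπ : ∀ i, 0 ≤ π i) (hπ1 : ∑ i, π i = 1)
    (hρ : ∀ i, IsDensity (ρ i)) : IsDensity (∑ i, (π i : ℂ) • ρ i) := by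
  refine ⟨Matrix.posSemidef_sum _ fun i _ => posSemidef_real_smul (hρ i).1 (hπ i), ?_⟩
  simp only [Matrix.trace_sum, Matrix.trace_smul, (hρ _).2, smul_eq_mul, mul_one]
  exact_mod_cast hπ1

lemma Matrix.PosSemidef.trace_eq_ofReal_re {n : Type*} [Fintype n] {M : Matrix n n ℂ}
    (hM : M.PosSemidef) : M.trace = (M.trace.re : ℂ) :=
  Complex.ext rfl (by simpa using (Complex.nonneg_iff.mp hM.trace_nonneg).2.symm)

lemma isDensity_normalize {n : Type*} [Fintype n] {M : Matrix n n ℂ} (hM : M.PosSemidef)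
    (h0 : 0 < M.trace.re) : IsDensity (((M.trace.re)⁻¹ : ℝ) • M : Matrix n n ℂ) := by
  have h : (((M.trace.re)⁻¹ : ℝ) • M : Matrix n n ℂ) = (((M.trace.re)⁻¹ : ℝ) : ℂ) • M := by
    ext; simp
  rw [h]
  refine ⟨posSemidef_real_smul hM (inv_nonneg.mpr h0.le), ?_⟩
  rw [Matrix.trace_smul, hM.trace_eq_ofReal_re, smul_eq_mul]
  simp only [Complex.ofReal_re]
  exact_mod_cast inv_mul_cancel₀ h0.ne'

lemma re_trace_mul_nonneg {n : Type*} [Fintype n] [DecidableEq n] {X ρ : Matrix n n ℂ}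
    (hX : X.PosSemidef) (hρ : ρ.PosSemidef) : 0 ≤ (X * ρ).trace.re := by
  obtain ⟨B, rfl⟩ := CStarAlgebra.nonneg_iff_eq_star_mul_self.mp hρ.nonneg
  rw [← mul_assoc, Matrix.trace_mul_comm, ← mul_assoc]
  exact (Complex.nonneg_iff.mp (hX.mul_mul_conjTranspose_same B).trace_nonneg).1

lemma re_trace_mul_mem_Icc {n : Type*} [Fintype n] [DecidableEq n] {E ρ : Matrix n n ℂ} {a b : ℝ}
    (ha : algebraMap ℝ (Matrix n n ℂ) a ≤ E) (hb : E ≤ algebraMap ℝ (Matrix n n ℂ) b)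
    (hρ : IsDensity ρ) : (E * ρ).trace.re ∈ Set.Icc a b := by
  have h1 := re_trace_mul_nonneg (Matrix.le_iff.mp ha) hρ.1
  have h2 := re_trace_mul_nonneg (Matrix.le_iff.mp hb) hρ.1
  simp only [Algebra.algebraMap_eq_smul_one, sub_mul, smul_mul_assoc, one_mul, Matrix.trace_sub,
    Matrix.trace_smul, hρ.2, Complex.sub_re, Complex.smul_re, Complex.one_re, smul_eq_mul,
    mul_one] at h1 h2
  exact ⟨by linarith, by linarith⟩

/-! ### The Holevo information -/

/-- The Holevo quantity of a finite ensemble. -/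
noncomputable def holevoInfo {n m : Type*} [Fintype m] [DecidableEq m]
    (Ψ : Matrix n n ℂ → Matrix m m ℂ) {N : ℕ} (π : Fin N → ℝ) (ρ : Fin N → Matrix n n ℂ) : ℝ :=
  vnEnt (Ψ (∑ i, (π i : ℂ) • ρ i)) - ∑ i, π i * vnEnt (Ψ (ρ i))

section Capacity

variable {n m : Type*} [Fintype n] [DecidableEq n] [Fintype m] [DecidableEq m]
  {Ψ : Matrix n n ℂ → Matrix m m ℂ}

lemma holevoInfo_le_holevoCap {c : ℝ}
    (hΨ : ∀ ρ, IsDensity ρ → 0 ≤ vnEnt (Ψ ρ) ∧ vnEnt (Ψ ρ) ≤ c) {N : ℕ} {π : Fin N → ℝ}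
    {ρ : Fin N → Matrix n n ℂ} (hπ : ∀ i, 0 ≤ π i) (hπ1 : ∑ i, π i = 1)
    (hρ : ∀ i, IsDensity (ρ i)) : holevoInfo Ψ π ρ ≤ holevoCap Ψ := by
  refine le_csSup ⟨c, ?_⟩ ⟨N, π, ρ, hπ, hπ1, hρ, rfl⟩
  rintro x ⟨N, π, ρ, hπ, hπ1, hρ, rfl⟩
  have h1 := (hΨ _ (IsDensity.sum hπ hπ1 hρ)).2
  have h2 : 0 ≤ ∑ i, π i * vnEnt (Ψ (ρ i)) :=
    Finset.sum_nonneg fun i _ => mul_nonneg (hπ i) (hΨ _ (hρ i)).1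
  linarith

lemma isDensity_maximally_mixed [Nonempty n] :
    IsDensity (((1 : Matrix n n ℂ).trace.re⁻¹ : ℝ) • (1 : Matrix n n ℂ)) :=
  isDensity_normalize Matrix.PosSemidef.one (by simp [Fintype.card_pos])

lemma holevoCap_le [Nonempty n] {c : ℝ}
    (h : ∀ (N : ℕ) (π : Fin N → ℝ) (ρ : Fin N → Matrix n n ℂ), (∀ i, 0 ≤ π i) →
      ∑ i, π i = 1 → (∀ i, IsDensity (ρ i)) → holevoInfo Ψ π ρ ≤ c) : holevoCap Ψ ≤ c := by
  refine csSup_le ⟨_, 1, fun _ => 1, fun _ => _, by simp, by simp,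
    fun _ => isDensity_maximally_mixed, rfl⟩ ?_
  rintro x ⟨N, π, ρ, hπ, hπ1, hρ, rfl⟩
  exact h N π ρ hπ hπ1 hρ

lemma holevoCap_nonneg [Nonempty n] {c : ℝ}
    (hΨ : ∀ ρ, IsDensity ρ → 0 ≤ vnEnt (Ψ ρ) ∧ vnEnt (Ψ ρ) ≤ c) : 0 ≤ holevoCap Ψ := by
  have h := holevoInfo_le_holevoCap hΨ (N := 1) (π := fun _ => 1) (ρ := fun _ => _)
    (by simp) (by simp) (fun _ => isDensity_maximally_mixed)
  simpa [holevoInfo] using h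

end Capacity

/-! ### Quantum operations in Kraus form -/

/-- The completely positive map with the given Kraus operators. -/
noncomputable def krausMap {d K : ℕ} (A : Fin K → Matrix (Fin d) (Fin d) ℂ)
    (X : Matrix (Fin d) (Fin d) ℂ) : Matrix (Fin d) (Fin d) ℂ :=
  ∑ k, A k * X * (A k)ᴴ

/-- The channel obtained from a quantum operation by pre-composing with conjugation by
the inverse square root of `E`. -/
noncomputable def normalizedKrausMap {d K : ℕ} (A : Fin K → Matrix (Fin d) (Fin d) ℂ)
    (E ρ : Matrix (Fin d) (Fin d) ℂ) : Matrix (Fin d) (Fin d) ℂ :=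
  krausMap A ((CFC.sqrt E)⁻¹ * ρ * (CFC.sqrt E)⁻¹)

section Kraus

variable {d K : ℕ} {A : Fin K → Matrix (Fin d) (Fin d) ℂ} {E : Matrix (Fin d) (Fin d) ℂ}

lemma krausMap_smul (c : ℂ) (X : Matrix (Fin d) (Fin d) ℂ) :
    krausMap A (c • X) = c • krausMap A X := by
  simp [krausMap, Finset.smul_sum]

lemma krausMap_posSemidef {X : Matrix (Fin d) (Fin d) ℂ} (hX : X.PosSemidef) :
    (krausMap A X).PosSemidef :=
  Matrix.posSemidef_sum _ fun k _ => hX.mul_mul_conjTranspose_same (A k)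

lemma trace_krausMap (hE : E = ∑ k, (A k)ᴴ * A k) (X : Matrix (Fin d) (Fin d) ℂ) :
    (krausMap A X).trace = (E * X).trace := by
  simp only [krausMap, hE, Matrix.trace_sum, Finset.sum_mul]
  exact Finset.sum_congr rfl fun k _ => by rw [Matrix.trace_mul_cycle]

lemma isHermitian_sqrt (E : Matrix (Fin d) (Fin d) ℂ) : (CFC.sqrt E).IsHermitian :=
  (CFC.sqrt_nonneg E).posSemidef.1

lemma isUnit_det_sqrt (hEpd : E.PosDef) : IsUnit (CFC.sqrt E).det := by
  have h : (CFC.sqrt E).det * (CFC.sqrt E).det = E.det := by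
    rw [← Matrix.det_mul, CFC.sqrt_mul_sqrt_self E hEpd.posSemidef.nonneg]
  exact isUnit_iff_ne_zero.mpr fun h0 => hEpd.det_pos.ne' (by rw [← h, h0, zero_mul])

lemma trace_sqrt_conj (hEpd : E.PosDef) (X : Matrix (Fin d) (Fin d) ℂ) :
    (CFC.sqrt E * X * CFC.sqrt E).trace = (E * X).trace := by
  rw [Matrix.trace_mul_cycle, CFC.sqrt_mul_sqrt_self E hEpd.posSemidef.nonneg]

lemma sqrt_conj_inv_sqrt_conj (hEpd : E.PosDef) (X : Matrix (Fin d) (Fin d) ℂ) :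
    CFC.sqrt E * ((CFC.sqrt E)⁻¹ * X * (CFC.sqrt E)⁻¹) * CFC.sqrt E = X := by
  rw [mul_assoc (CFC.sqrt E)⁻¹, Matrix.mul_nonsing_inv_cancel_left _ _ (isUnit_det_sqrt hEpd),
    Matrix.nonsing_inv_mul_cancel_right _ _ (isUnit_det_sqrt hEpd)]

lemma inv_sqrt_conj_sqrt_conj (hEpd : E.PosDef) (X : Matrix (Fin d) (Fin d) ℂ) :
    (CFC.sqrt E)⁻¹ * (CFC.sqrt E * X * CFC.sqrt E) * (CFC.sqrt E)⁻¹ = X := by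
  rw [mul_assoc (CFC.sqrt E), Matrix.nonsing_inv_mul_cancel_left _ _ (isUnit_det_sqrt hEpd),
    Matrix.mul_nonsing_inv_cancel_right _ _ (isUnit_det_sqrt hEpd)]

lemma sqrt_conj_posSemidef {X : Matrix (Fin d) (Fin d) ℂ} (hX : X.PosSemidef) :
    (CFC.sqrt E * X * CFC.sqrt E).PosSemidef := by
  simpa only [(isHermitian_sqrt E).eq] using hX.mul_mul_conjTranspose_same (CFC.sqrt E)

lemma inv_sqrt_conj_posSemidef {X : Matrix (Fin d) (Fin d) ℂ} (hX : X.PosSemidef) :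
    ((CFC.sqrt E)⁻¹ * X * (CFC.sqrt E)⁻¹).PosSemidef := by
  simpa only [(isHermitian_sqrt E).inv.eq] using hX.mul_mul_conjTranspose_same (CFC.sqrt E)⁻¹

lemma isDensity_normalizedKrausMap (hE : E = ∑ k, (A k)ᴴ * A k) (hEpd : E.PosDef)
    {τ : Matrix (Fin d) (Fin d) ℂ} (hτ : IsDensity τ) : IsDensity (normalizedKrausMap A E τ) := by
  refine ⟨krausMap_posSemidef (inv_sqrt_conj_posSemidef hτ.1), ?_⟩
  rw [normalizedKrausMap, trace_krausMap hE, ← trace_sqrt_conj hEpd,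
    sqrt_conj_inv_sqrt_conj hEpd, hτ.2]

lemma vnEnt_gec_krausMap (hE : E = ∑ k, (A k)ᴴ * A k) (hEpd : E.PosDef)
    {ρ τ : Matrix (Fin d) (Fin d) ℂ} {q : ℝ} (hρ : IsDensity ρ) (hτ : IsDensity τ)
    (h : (q : ℂ) • τ = CFC.sqrt E * ρ * CFC.sqrt E) :
    vnEnt (gec (krausMap A) ρ) = q * vnEnt (normalizedKrausMap A E τ) + binEnt q := by
  have hΦ := isDensity_normalizedKrausMap hE hEpd hτ
  have hΛ : krausMap A ρ = (q : ℂ) • normalizedKrausMap A E τ := by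
    rw [normalizedKrausMap, ← krausMap_smul, ← smul_mul_assoc, ← mul_smul_comm, h,
      inv_sqrt_conj_sqrt_conj hEpd]
  rw [vnEnt_gec (krausMap_posSemidef hρ.1).1 (q := q) hρ.2
      (by rw [hΛ, Matrix.trace_smul, hΦ.2, smul_eq_mul, mul_one]),
    hΛ, vnEnt_real_smul hΦ.1.1, hΦ.2, binEnt_eq_negMulLog]
  simp only [Complex.one_re]
  ring

lemma vnEnt_normalizedKrausMap_mem (hE : E = ∑ k, (A k)ᴴ * A k) (hEpd : E.PosDef)
    (τ : Matrix (Fin d) (Fin d) ℂ) (hτ : IsDensity τ) :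
    0 ≤ vnEnt (normalizedKrausMap A E τ) ∧ vnEnt (normalizedKrausMap A E τ) ≤ d := by
  have h := isDensity_normalizedKrausMap hE hEpd hτ
  exact ⟨vnEnt_nonneg h.1 (by simp [h.2]), by simpa using vnEnt_le_card h.1⟩

lemma vnEnt_gec_krausMap_mem (hE : E = ∑ k, (A k)ᴴ * A k) {a b : ℝ} (ha : 0 ≤ a) (hb : b ≤ 1)
    (hEa : algebraMap ℝ _ a ≤ E) (hEb : E ≤ algebraMap ℝ _ b)
    (ρ : Matrix (Fin d) (Fin d) ℂ) (hρ : IsDensity ρ) :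
    0 ≤ vnEnt (gec (krausMap A) ρ) ∧ vnEnt (gec (krausMap A) ρ) ≤ d + 1 := by
  have hpsd := krausMap_posSemidef (A := A) hρ.1
  have hq := re_trace_mul_mem_Icc hEa hEb hρ
  rw [← trace_krausMap hE] at hq
  have hq0 : 0 ≤ 1 - (krausMap A ρ).trace.re := by linarith [hq.2]
  rw [vnEnt_gec hpsd.1 hρ.2 hpsd.trace_eq_ofReal_re]
  have h1 := vnEnt_nonneg hpsd (hq.2.trans hb)
  have h2 := vnEnt_le_card hpsd
  have h3 := Real.negMulLog_nonneg hq0 (by linarith [hq.1])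
  have h4 := Real.negMulLog_le_one_sub_self hq0
  rw [Fintype.card_fin] at h2
  exact ⟨by linarith, by linarith⟩

/-- Comparison of the Holevo quantities of an ensemble for the erasure channel and of the
corresponding reweighted ensemble for the normalised channel. -/
lemma holevoInfo_gec_bounds (hE : E = ∑ k, (A k)ᴴ * A k) (hEpd : E.PosDef)
    {a b : ℝ} (ha : 0 ≤ a) (hb : b ≤ 1)
    (hEa : algebraMap ℝ _ a ≤ E) (hEb : E ≤ algebraMap ℝ _ b)
    {N : ℕ} {μ π p : Fin N → ℝ} {q : ℝ} {ρ τ : Fin N → Matrix (Fin d) (Fin d) ℂ}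
    (hμ : ∀ i, 0 ≤ μ i) (hμ1 : ∑ i, μ i = 1) (hρ : ∀ i, IsDensity (ρ i))
    (hπ : ∀ i, 0 ≤ π i) (hπ1 : ∑ i, π i = 1) (hτ : ∀ i, IsDensity (τ i))
    (hp : ∀ i, (p i : ℂ) • τ i = CFC.sqrt E * ρ i * CFC.sqrt E)
    (hq : ∀ i, μ i * p i = q * π i) :
    q ∈ Set.Icc a b ∧
    q * holevoInfo (normalizedKrausMap A E) π τ ≤ holevoInfo (gec (krausMap A)) μ ρ ∧
    holevoInfo (gec (krausMap A)) μ ρ ≤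
      q * holevoInfo (normalizedKrausMap A E) π τ + Fbound a b := by
  have hsum : ∑ i, μ i * p i = q := by simp_rw [hq, ← Finset.mul_sum, hπ1, mul_one]
  have hmem : ∀ i, p i ∈ Set.Icc a b := fun i => by
    have h := re_trace_mul_mem_Icc hEa hEb (hρ i)
    rw [← trace_sqrt_conj hEpd, ← hp i, Matrix.trace_smul, (hτ i).2] at h
    simpa using h
  have hgap := binEnt_jensen_gap ha hb hμ hμ1 hmem
  rw [hsum] at hgap
  have hav : (q : ℂ) • ∑ i, (π i : ℂ) • τ i =
      CFC.sqrt E * (∑ i, (μ i : ℂ) • ρ i) * CFC.sqrt E := by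
    simp_rw [Finset.mul_sum, Finset.sum_mul, Finset.smul_sum, mul_smul_comm, smul_mul_assoc,
      ← hp, smul_smul]
    exact Finset.sum_congr rfl fun i _ => by
      congr 1
      exact_mod_cast (hq i).symm
  have hkey : holevoInfo (gec (krausMap A)) μ ρ =
      q * holevoInfo (normalizedKrausMap A E) π τ +
        (binEnt q - ∑ i, μ i * binEnt (p i)) := by
    have hs : ∑ i, μ i * vnEnt (gec (krausMap A) (ρ i)) =
        q * ∑ i, π i * vnEnt (normalizedKrausMap A E (τ i)) + ∑ i, μ i * binEnt (p i) := by
      rw [Finset.mul_sum, ← Finset.sum_add_distrib]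
      refine Finset.sum_congr rfl fun i _ => ?_
      rw [vnEnt_gec_krausMap hE hEpd (hρ i) (hτ i) (hp i), ← mul_assoc q, ← hq i]
      ring
    rw [holevoInfo, hs, vnEnt_gec_krausMap hE hEpd (IsDensity.sum hμ hμ1 hρ)
      (IsDensity.sum hπ hπ1 hτ) hav, holevoInfo]
    ring
  refine ⟨?_, by linarith, by linarith⟩
  rw [← hsum]
  simpa using (convex_Icc a b).sum_mem (fun i _ => hμ i) hμ1 (fun i _ => hmem i)

lemma holevoCap_gec_le [NeZero d] (hE : E = ∑ k, (A k)ᴴ * A k) (hEpd : E.PosDef)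
    {a b : ℝ} (ha : 0 < a) (hb : b ≤ 1)
    (hEa : algebraMap ℝ _ a ≤ E) (hEb : E ≤ algebraMap ℝ _ b) :
    holevoCap (gec (krausMap A)) ≤ b * holevoCap (normalizedKrausMap A E) + Fbound a b := by
  refine holevoCap_le fun N μ ρ hμ hμ1 hρ => ?_
  have hM : ∀ i, (CFC.sqrt E * ρ i * CFC.sqrt E).PosSemidef :=
    fun i => sqrt_conj_posSemidef (hρ i).1
  set p : Fin N → ℝ := fun i => (CFC.sqrt E * ρ i * CFC.sqrt E).trace.re
  have hmem : ∀ i, p i ∈ Set.Icc a b := fun i => by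
    have h := re_trace_mul_mem_Icc hEa hEb (hρ i)
    rwa [← trace_sqrt_conj hEpd] at h
  have hp0 : ∀ i, 0 < p i := fun i => ha.trans_le (hmem i).1
  set q := ∑ i, μ i * p i
  have hq0 : 0 < q := by
    have h : q ∈ Set.Icc a b := by
      simpa using (convex_Icc a b).sum_mem (fun i _ => hμ i) hμ1 (fun i _ => hmem i)
    exact ha.trans_le h.1
  have hπ : ∀ i, 0 ≤ μ i * p i / q :=
    fun i => div_nonneg (mul_nonneg (hμ i) (hp0 i).le) hq0.le
  have hπ1 : ∑ i, μ i * p i / q = 1 := by rw [← Finset.sum_div, div_self hq0.ne']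
  have hτ : ∀ i, IsDensity ((p i)⁻¹ • (CFC.sqrt E * ρ i * CFC.sqrt E)) :=
    fun i => isDensity_normalize (hM i) (hp0 i)
  obtain ⟨hqmem, -, h⟩ := holevoInfo_gec_bounds hE hEpd ha.le hb hEa hEb hμ hμ1 hρ hπ hπ1 hτ
    (p := p) (fun i => by rw [Complex.coe_smul, smul_inv_smul₀ (hp0 i).ne'])
    (fun i => by rw [mul_div_cancel₀ _ hq0.ne'])
  have hbd := vnEnt_normalizedKrausMap_mem hE hEpd
  have h1 := mul_le_mul_of_nonneg_left (holevoInfo_le_holevoCap hbd hπ hπ1 hτ) hq0.le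
  have h2 := mul_le_mul_of_nonneg_right hqmem.2 (holevoCap_nonneg hbd)
  linarith

lemma mul_holevoCap_le_gec [NeZero d] (hE : E = ∑ k, (A k)ᴴ * A k) (hEpd : E.PosDef)
    {a b : ℝ} (ha : 0 < a) (hb : b ≤ 1)
    (hEa : algebraMap ℝ _ a ≤ E) (hEb : E ≤ algebraMap ℝ _ b) :
    a * holevoCap (normalizedKrausMap A E) ≤ holevoCap (gec (krausMap A)) := by
  rw [← le_div_iff₀' ha]
  refine holevoCap_le fun N π τ hπ hπ1 hτ => ?_
  rw [le_div_iff₀' ha]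
  have hbd := vnEnt_gec_krausMap_mem hE ha.le hb hEa hEb
  rcases le_total (holevoInfo (normalizedKrausMap A E) π τ) 0 with hneg | hpos
  · exact (mul_nonpos_of_nonneg_of_nonpos ha.le hneg).trans (holevoCap_nonneg hbd)
  have hM : ∀ i, ((CFC.sqrt E)⁻¹ * τ i * (CFC.sqrt E)⁻¹).PosSemidef :=
    fun i => inv_sqrt_conj_posSemidef (hτ i).1
  set r : Fin N → ℝ := fun i => ((CFC.sqrt E)⁻¹ * τ i * (CFC.sqrt E)⁻¹).trace.re
  have hr0 : ∀ i, 0 < r i := fun i => by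
    refine lt_of_le_of_ne (Complex.nonneg_iff.mp (hM i).trace_nonneg).1 fun h0 => ?_
    have htr : _ = (r i : ℂ) := (hM i).trace_eq_ofReal_re
    rw [← h0, Complex.ofReal_zero, (hM i).trace_eq_zero_iff] at htr
    have h1 := sqrt_conj_inv_sqrt_conj hEpd (τ i)
    rw [htr, mul_zero, zero_mul] at h1
    simpa [← h1] using (hτ i).2
  set z := ∑ i, π i * r i
  have hz0 : 0 < z := by
    obtain ⟨i, hi⟩ : ∃ i, 0 < π i := by
      by_contra! h
      linarith [Finset.sum_nonpos fun i (_ : i ∈ Finset.univ) => h i]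
    exact Finset.sum_pos' (fun j _ => mul_nonneg (hπ j) (hr0 j).le)
      ⟨i, Finset.mem_univ i, mul_pos hi (hr0 i)⟩
  have hμ : ∀ i, 0 ≤ π i * r i / z :=
    fun i => div_nonneg (mul_nonneg (hπ i) (hr0 i).le) hz0.le
  have hμ1 : ∑ i, π i * r i / z = 1 := by rw [← Finset.sum_div, div_self hz0.ne']
  have hρ : ∀ i, IsDensity ((r i)⁻¹ • ((CFC.sqrt E)⁻¹ * τ i * (CFC.sqrt E)⁻¹)) :=
    fun i => isDensity_normalize (hM i) (hr0 i)
  obtain ⟨hqmem, h, -⟩ := holevoInfo_gec_bounds hE hEpd ha.le hb hEa hEb hμ hμ1 hρ hπ hπ1 hτ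
    (p := fun i => (r i)⁻¹) (q := z⁻¹)
    (fun i => by
      rw [Complex.coe_smul, mul_smul_comm, smul_mul_assoc, sqrt_conj_inv_sqrt_conj hEpd])
    (fun i => by have := (hr0 i).ne'; field_simp)
  exact (mul_le_mul_of_nonneg_right hqmem.1 hpos).trans
    (h.trans (holevoInfo_le_holevoCap hbd hμ hμ1 hρ))

end Kraus

/-- p_min·C_χ(Φ_Λ) ≤ C_χ(Γ_Λ) ≤ p_max·C_χ(Φ_Λ) + F(p_min, p_max). -/
theorem holevo_capacity_gec_bounds (d K : ℕ) (hd : 1 ≤ d)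
    (A : Fin K → Matrix (Fin d) (Fin d) ℂ)
    (E : Matrix (Fin d) (Fin d) ℂ)
    (hE : E = ∑ k, (A k)ᴴ * A k)
    (hEpd : E.PosDef)
    (hE1 : (1 - E).PosSemidef) :
    (⨅ i, hEpd.1.eigenvalues i) *
        holevoCap (fun ρ => ∑ k, A k *
          ((CFC.sqrt E)⁻¹ * ρ * (CFC.sqrt E)⁻¹) * (A k)ᴴ)
      ≤ holevoCap (gec (fun X => ∑ k, A k * X * (A k)ᴴ)) ∧
    holevoCap (gec (fun X => ∑ k, A k * X * (A k)ᴴ))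
      ≤ (⨆ i, hEpd.1.eigenvalues i) *
          holevoCap (fun ρ => ∑ k, A k *
            ((CFC.sqrt E)⁻¹ * ρ * (CFC.sqrt E)⁻¹) * (A k)ᴴ)
        + Fbound (⨅ i, hEpd.1.eigenvalues i) (⨆ i, hEpd.1.eigenvalues i) := by
  have : NeZero d := ⟨by omega⟩
  have hfin := Set.finite_range hEpd.1.eigenvalues
  have ha : 0 < ⨅ i, hEpd.1.eigenvalues i := by
    obtain ⟨i, hi⟩ := exists_eq_ciInf_of_finite (f := hEpd.1.eigenvalues)
    rw [← hi]
    exact hEpd.eigenvalues_pos i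
  have hb : ⨆ i, hEpd.1.eigenvalues i ≤ 1 := by
    refine ciSup_le fun i => ?_
    have h := (le_algebraMap_iff_spectrum_le (r := (1 : ℝ)) (a := E) hEpd.1.isSelfAdjoint).mp
      (by simpa using Matrix.le_iff.mpr hE1)
    exact h _ (hEpd.1.eigenvalues_mem_spectrum_real i)
  have hEa : algebraMap ℝ _ (⨅ i, hEpd.1.eigenvalues i) ≤ E := by
    rw [algebraMap_le_iff_le_spectrum (ha := hEpd.1.isSelfAdjoint),
      hEpd.1.spectrum_real_eq_range_eigenvalues]
    rintro _ ⟨i, rfl⟩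
    exact ciInf_le hfin.bddBelow i
  have hEb : E ≤ algebraMap ℝ _ (⨆ i, hEpd.1.eigenvalues i) := by
    rw [le_algebraMap_iff_spectrum_le (ha := hEpd.1.isSelfAdjoint),
      hEpd.1.spectrum_real_eq_range_eigenvalues]
    rintro _ ⟨i, rfl⟩
    exact le_ciSup hfin.bddAbove i
  exact ⟨mul_holevoCap_le_gec hE hEpd ha hb hEa hEb, holevoCap_gec_le hE hEpd ha hb hEa hEb⟩
end

section
/- Let A be a d×d complex matrix with AᴴA ≤ I, let B = √(I − AᴴA), and let Γ(ρ) = diag-blocks(AρAᴴ, tr(BρB)) and Γ̃(ρ) = diag-blocks(tr(AρAᴴ), BρB) be the generalized erasure channel of Λ(ρ) = AρAᴴ and its complementary channel, both mapping d×d matrices to (d+1)×(d+1) matrices. Then the following are equivalent: (i) there exist finitely many (d+1)×(d+1) matrices K_1,…,K_M with Σ_m K_mᴴ K_m = I such that Σ_m K_m Γ(ρ) K_mᴴ = Γ̃(ρ) for every d×d matrix ρ (i.e., Γ is degradable); (ii) AAᴴ ≥ (1/2)·I in the Loewner order, or the matrix I − AᴴA has rank 1. -/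
open Matrix ComplexOrder MatrixOrder

section ErasureChannel

variable {m n ι : Type*} [Fintype m] [Fintype n] [Fintype ι]

lemma star_dotProduct_conj_vecMulVec_mulVec (K : Matrix m n ℂ) (y : m → ℂ) (z : n → ℂ) :
    star y ⬝ᵥ (K * vecMulVec z (star z) * Kᴴ) *ᵥ y
      = (star y ⬝ᵥ K *ᵥ z) * star (star y ⬝ᵥ K *ᵥ z) := by
  rw [mul_vecMulVec, vecMulVec_mul, vecMulVec_mulVec, ← star_mulVec, op_smul_eq_smul,
    dotProduct_smul, smul_eq_mul, mul_comm, ← star_dotProduct_star, star_star]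

lemma mul_star_star_dotProduct_le (x y : m → ℂ) :
    (star y ⬝ᵥ x) * star (star y ⬝ᵥ x) ≤ (star y ⬝ᵥ y) * (star x ⬝ᵥ x) := by
  have h := inner_mul_inner_self_le (𝕜 := ℂ) (WithLp.toLp 2 y) (WithLp.toLp 2 x)
  rw [norm_inner_symm (WithLp.toLp 2 x), ← sq] at h
  simp only [EuclideanSpace.inner_toLp_toLp, dotProduct_comm _ (star _)] at h
  have hre (z : m → ℂ) : star z ⬝ᵥ z = ((star z ⬝ᵥ z).re : ℂ) :=
    (Complex.eq_re_of_ofReal_le (dotProduct_star_self_nonneg z))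
  rw [hre x, hre y, Complex.star_def, Complex.mul_conj']
  exact_mod_cast h

lemma sum_mul_star_le_of_sum_conjTranspose_mul_eq_one [DecidableEq n] {K : ι → Matrix m n ℂ}
    (hK : ∑ i, (K i)ᴴ * K i = 1) (y : m → ℂ) (z : n → ℂ) :
    ∑ i, (star y ⬝ᵥ K i *ᵥ z) * star (star y ⬝ᵥ K i *ᵥ z) ≤ (star y ⬝ᵥ y) * (star z ⬝ᵥ z) := by
  calc
    _ ≤ ∑ i, (star y ⬝ᵥ y) * (star (K i *ᵥ z) ⬝ᵥ K i *ᵥ z) :=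
      Finset.sum_le_sum fun i _ => mul_star_star_dotProduct_le _ _
    _ = (star y ⬝ᵥ y) * (star z ⬝ᵥ (∑ i, (K i)ᴴ * K i) *ᵥ z) := by
      rw [← Finset.mul_sum, sum_mulVec, dotProduct_sum]
      simp only [star_mulVec, ← dotProduct_mulVec, mulVec_mulVec]
    _ = _ := by rw [hK, one_mulVec]

lemma fromBlocks_vecMulVec_star {m : Type*} (z : m → ℂ) (t : ℂ) :
    fromBlocks (vecMulVec z (star z)) 0 0 (of fun _ _ : Fin 1 => t)
      = vecMulVec (Sum.elim z 0) (star (Sum.elim z 0))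
        + t • vecMulVec (Sum.elim 0 1) (star (Sum.elim 0 1)) := by
  ext (i | i) (j | j) <;> simp [vecMulVec_apply]

lemma star_sum_elim_zero_dotProduct_fromBlocks_mulVec (X : Matrix (Fin 1) (Fin 1) ℂ)
    (Y : Matrix m m ℂ) (v : m → ℂ) :
    star (Sum.elim (0 : Fin 1 → ℂ) v) ⬝ᵥ fromBlocks X 0 0 Y *ᵥ Sum.elim 0 v
      = star v ⬝ᵥ Y *ᵥ v := by
  simp [fromBlocks_mulVec, dotProduct, Function.comp_def]

/-- Degradability forces `|⟨v, Bv⟩|² ≤ ‖v‖² ‖Av‖²` whenever some `w` with `Bw ≠ 0` satisfies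
`⟨v, Bw⟩ = 0`: such a `w` shows that an erased state cannot be degraded towards `v`. -/
lemma mul_star_le_of_degrading [DecidableEq n] {K : ι → Matrix (Fin 1 ⊕ n) (n ⊕ Fin 1) ℂ}
    {A B : Matrix n n ℂ} (hB : B.IsHermitian) (hK : ∑ i, (K i)ᴴ * K i = 1)
    (hdeg : ∀ ρ : Matrix n n ℂ,
      ∑ i, K i * fromBlocks (A * ρ * Aᴴ) 0 0 (of fun _ _ : Fin 1 => (B * ρ * B).trace) * (K i)ᴴ
        = fromBlocks (of fun _ _ => (A * ρ * Aᴴ).trace) 0 0 (B * ρ * B))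
    {v w : n → ℂ} (hvw : star v ⬝ᵥ B *ᵥ w = 0) (hw : B *ᵥ w ≠ 0) :
    (star v ⬝ᵥ B *ᵥ v) * star (star v ⬝ᵥ B *ᵥ v)
      ≤ (star v ⬝ᵥ v) * (star (A *ᵥ v) ⬝ᵥ A *ᵥ v) := by
  set y : Fin 1 ⊕ n → ℂ := Sum.elim 0 v with hy
  set e : n ⊕ Fin 1 → ℂ := Sum.elim 0 1
  have key (u : n → ℂ) :
      ∑ i, (star y ⬝ᵥ K i *ᵥ Sum.elim (A *ᵥ u) 0) * star (star y ⬝ᵥ K i *ᵥ Sum.elim (A *ᵥ u) 0)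
        + (star (B *ᵥ u) ⬝ᵥ B *ᵥ u) * ∑ i, (star y ⬝ᵥ K i *ᵥ e) * star (star y ⬝ᵥ K i *ᵥ e)
      = (star v ⬝ᵥ B *ᵥ u) * star (star v ⬝ᵥ B *ᵥ u) := by
    have hAu : A * vecMulVec u (star u) * Aᴴ = vecMulVec (A *ᵥ u) (star (A *ᵥ u)) := by
      rw [mul_vecMulVec, vecMulVec_mul, star_mulVec]
    have hBu : (B * vecMulVec u (star u) * B).trace = star (B *ᵥ u) ⬝ᵥ B *ᵥ u := by
      rw [mul_vecMulVec, vecMulVec_mul, star_mulVec, hB.eq, trace_vecMulVec, dotProduct_comm]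
    have h := congrArg (fun X => star y ⬝ᵥ X *ᵥ y) (hdeg (vecMulVec u (star u)))
    simp only [hy, star_sum_elim_zero_dotProduct_fromBlocks_mulVec] at h
    rw [← hy] at h
    nth_rw 4 [← hB.eq] at h
    rw [star_dotProduct_conj_vecMulVec_mulVec, hAu, hBu, fromBlocks_vecMulVec_star, sum_mulVec,
      dotProduct_sum] at h
    simp only [Matrix.mul_add, Matrix.add_mul, add_mulVec, dotProduct_add, Matrix.mul_smul,
      smul_mul, smul_mulVec, dotProduct_smul, star_dotProduct_conj_vecMulVec_mulVec,
      Finset.sum_add_distrib,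
      smul_eq_mul, ← Finset.mul_sum] at h
    exact h
  have hnn (z : n ⊕ Fin 1 → ℂ) :
      0 ≤ ∑ i, (star y ⬝ᵥ K i *ᵥ z) * star (star y ⬝ᵥ K i *ᵥ z) :=
    Finset.sum_nonneg fun i _ => mul_star_self_nonneg _
  have he : ∑ i, (star y ⬝ᵥ K i *ᵥ e) * star (star y ⬝ᵥ K i *ᵥ e) = 0 := by
    have h := key w
    rw [hvw, zero_mul] at h
    have h2 := (add_eq_zero_iff_of_nonneg (hnn _)
      (mul_nonneg (dotProduct_star_self_nonneg _) (hnn e))).1 h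
    exact (mul_eq_zero.1 h2.2).resolve_left (mt dotProduct_star_self_eq_zero.1 hw)
  have h := sum_mul_star_le_of_sum_conjTranspose_mul_eq_one hK y (Sum.elim (A *ᵥ v) 0)
  have h1 := key v
  rw [he, mul_zero, add_zero] at h1
  rw [h1] at h
  simpa [hy, dotProduct] using h

/-- A quantum operation with blocks `X ↦ tr (C X Cᴴ) ⊕ L X Lᴴ` and `t ↦ c t cᴴ ⊕ a t aᴴ`,
given by finitely many Kraus operators. -/
lemma exists_kraus [DecidableEq n] (C L : Matrix n n ℂ) (c : Matrix (Fin 1) (Fin 1) ℂ)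
    (a : Matrix n (Fin 1) ℂ)
    (hCL : Cᴴ * C + Lᴴ * L = 1) (hca : cᴴ * c + aᴴ * a = 1) :
    ∃ (M : ℕ) (K : Fin M → Matrix (Fin 1 ⊕ n) (n ⊕ Fin 1) ℂ), ∑ i, (K i)ᴴ * K i = 1 ∧
      ∀ (X : Matrix n n ℂ) (T : Matrix (Fin 1) (Fin 1) ℂ),
        ∑ i, K i * fromBlocks X 0 0 T * (K i)ᴴ
          = fromBlocks ((of fun _ _ => (C * X * Cᴴ).trace) + c * T * cᴴ) 0 0
              (L * X * Lᴴ + a * T * aᴴ) := by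
  let F : n ⊕ Fin 3 → Matrix (Fin 1 ⊕ n) (n ⊕ Fin 1) ℂ :=
    Sum.elim (fun i => fromBlocks (of fun _ j => C i j) 0 0 0)
      ![fromBlocks 0 0 L 0, fromBlocks 0 c 0 0, fromBlocks 0 0 0 a]
  let σ := (Fintype.equivFin (n ⊕ Fin 3)).symm
  refine ⟨_, F ∘ σ, ?_, fun X T => ?_⟩
  · simp only [Function.comp_apply]
    rw [σ.sum_comp fun i => (F i)ᴴ * F i, ← fromBlocks_one, ← hCL, ← hca]
    simp only [F, Fintype.sum_sum_type, Fin.sum_univ_three, Sum.elim_inl, Sum.elim_inr,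
      fromBlocks_conjTranspose, fromBlocks_multiply]
    ext (i | i) (j | j) <;> simp [Matrix.sum_apply, mul_apply]
  · simp only [Function.comp_apply]
    rw [σ.sum_comp fun i => F i * fromBlocks X 0 0 T * (F i)ᴴ]
    simp only [F, Fintype.sum_sum_type, Fin.sum_univ_three, Sum.elim_inl, Sum.elim_inr,
      fromBlocks_conjTranspose, fromBlocks_multiply]
    ext (i | i) (j | j) <;> simp [Matrix.sum_apply, mul_apply, trace]

lemma exists_eq_vecMulVec_of_rank_eq_one {B : Matrix m n ℂ} (h : B.rank = 1) :
    ∃ a c, B = vecMulVec a c := by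
  obtain ⟨⟨a, _⟩, -, ha⟩ := finrank_eq_one_iff'.1 ((rank_eq_finrank_span_cols B).symm.trans h)
  choose c hc using fun j => ha ⟨B.col j, Submodule.subset_span ⟨j, rfl⟩⟩
  refine ⟨a, c, ?_⟩
  ext i j
  have := congrFun (congrArg Subtype.val (hc j)) i
  simp [vecMulVec_apply] at this ⊢
  rw [← this, mul_comm]

lemma rank_eq_one_of_mulVec_eq_zero {m : Type*} {G : Matrix m n ℂ} {v : n → ℂ} (hv : G *ᵥ v ≠ 0)
    (h : ∀ w, star v ⬝ᵥ w = 0 → G *ᵥ w = 0) : G.rank = 1 := by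
  have hv0 : star v ⬝ᵥ v ≠ 0 := by
    rw [Ne, dotProduct_star_self_eq_zero]
    rintro rfl
    simp at hv
  have hG : G = vecMulVec (G *ᵥ v) ((star v ⬝ᵥ v)⁻¹ • star v) := by
    refine mulVec_injective (funext fun x => ?_)
    have hx := h (x - ((star v ⬝ᵥ v)⁻¹ * (star v ⬝ᵥ x)) • v) (by
      rw [dotProduct_sub, dotProduct_smul, smul_eq_mul]
      field_simp
      ring)
    rw [mulVec_sub, mulVec_smul, sub_eq_zero] at hx
    rw [hx, vecMulVec_mulVec, op_smul_eq_smul, smul_dotProduct, smul_eq_mul]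
  refine le_antisymm (hG ▸ rank_vecMulVec_le _ _) (Nat.one_le_iff_ne_zero.2 fun h0 => hv ?_)
  have := Submodule.finrank_eq_zero.1
    (show Module.finrank ℂ (LinearMap.range G.mulVecLin) = 0 from h0)
  exact congrFun (congrArg DFunLike.coe (LinearMap.range_eq_bot.1 this)) v

lemma exists_conjTranspose_mul_mulVec_eq_smul [DecidableEq n] {A : Matrix n n ℂ} {r : ℝ}
    (h : ¬ (A * Aᴴ - (r : ℂ) • 1).PosSemidef) :
    ∃ (v : n → ℂ) (μ : ℝ), v ≠ 0 ∧ μ < r ∧ (Aᴴ * A) *ᵥ v = (μ : ℂ) • v := by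
  have hH : (A * Aᴴ - (r : ℂ) • 1).IsHermitian := by
    simp [IsHermitian]
  rw [hH.posSemidef_iff_eigenvalues_nonneg, Pi.le_def] at h
  push Not at h
  obtain ⟨i, hi⟩ := h
  let μ := r + hH.eigenvalues i
  have hu : (scalar n (μ : ℂ) - A * Aᴴ) *ᵥ (hH.eigenvectorBasis i).ofLp = 0 := by
    have := hH.mulVec_eigenvectorBasis i
    rw [sub_mulVec, smul_mulVec, one_mulVec, sub_eq_iff_eq_add] at this
    rw [sub_mulVec, this, scalar_apply, ← smul_one_eq_diagonal, smul_mulVec, one_mulVec,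
      Complex.ofReal_add, add_smul, Complex.coe_smul (hH.eigenvalues i), add_comm, sub_self]
  have hu0 : (hH.eigenvectorBasis i).ofLp ≠ 0 := by
    simpa using hH.eigenvectorBasis.orthonormal.ne_zero i
  have hdet := exists_mulVec_eq_zero_iff.1 ⟨_, hu0, hu⟩
  rw [← eval_charpoly, charpoly_mul_comm, eval_charpoly] at hdet
  obtain ⟨v, hv0, hv⟩ := exists_mulVec_eq_zero_iff.2 hdet
  refine ⟨v, μ, hv0, add_lt_of_neg_right _ hi, ?_⟩
  rw [sub_mulVec, sub_eq_zero, scalar_apply, ← smul_one_eq_diagonal, smul_mulVec,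
    one_mulVec] at hv
  exact hv.symm

lemma mulVec_eq_smul_of_mul_self_mulVec {B : Matrix n n ℂ} (hB : B.PosSemidef) {b : ℝ} (hb : 0 < b)
    {v : n → ℂ} (h : (B * B) *ᵥ v = ((b : ℂ) * b) • v) : B *ᵥ v = (b : ℂ) • v := by
  have hx : B *ᵥ (B *ᵥ v - (b : ℂ) • v) = -((b : ℂ) • (B *ᵥ v - (b : ℂ) • v)) := by
    rw [mulVec_sub, mulVec_mulVec, h, mulVec_smul, smul_sub, smul_smul]
    abel
  have h0 := hB.dotProduct_mulVec_nonneg (B *ᵥ v - (b : ℂ) • v)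
  rw [hx, dotProduct_neg, dotProduct_smul, smul_eq_mul, neg_nonneg] at h0
  have h1 := dotProduct_star_self_nonneg (B *ᵥ v - (b : ℂ) • v)
  have hb' : (0 : ℂ) < b := by exact_mod_cast hb
  have h2 := le_antisymm h0 (mul_nonneg hb'.le h1)
  exact sub_eq_zero.1 (dotProduct_star_self_eq_zero.1 ((mul_eq_zero.1 h2).resolve_left hb'.ne'))

lemma exists_degrading [DecidableEq n] {A B C L : Matrix n n ℂ} {c : Matrix (Fin 1) (Fin 1) ℂ}
    {a : Matrix n (Fin 1) ℂ} (hCL : Cᴴ * C + Lᴴ * L = 1) (hca : cᴴ * c + aᴴ * a = 1)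
    (h : ∀ ρ, L * (A * ρ * Aᴴ) * Lᴴ + (B * ρ * B).trace • (a * aᴴ) = B * ρ * B) :
    ∃ (M : ℕ) (K : Fin M → Matrix (Fin 1 ⊕ n) (n ⊕ Fin 1) ℂ), ∑ i, (K i)ᴴ * K i = 1 ∧
      ∀ ρ : Matrix n n ℂ,
        ∑ i, K i * fromBlocks (A * ρ * Aᴴ) 0 0 (of fun _ _ : Fin 1 => (B * ρ * B).trace) * (K i)ᴴ
          = fromBlocks (of fun _ _ => (A * ρ * Aᴴ).trace) 0 0 (B * ρ * B) := by
  obtain ⟨M, K, hK, hKX⟩ := exists_kraus C L c a hCL hca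
  refine ⟨M, K, hK, fun ρ => ?_⟩
  have hT (t : ℂ) : (of fun _ _ : Fin 1 => t) = t • (1 : Matrix (Fin 1) (Fin 1) ℂ) := by
    ext i j
    simp [Subsingleton.elim i j]
  rw [hKX]
  congr 1
  · have h1 := congrArg trace (h ρ)
    have h2 := congrArg (fun X => (X * (A * ρ * Aᴴ)).trace) hCL
    have h3 := congrArg trace hca
    simp only [add_mul, one_mul, trace_add, trace_smul, smul_eq_mul] at h1 h2 h3
    rw [trace_mul_comm aᴴ, trace_mul_comm cᴴ, trace_one, Fintype.card_fin, Nat.cast_one] at h3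
    rw [← trace_mul_cycle C, ← trace_mul_cycle L] at h2
    simp only [hT (B * ρ * B).trace, Matrix.mul_smul, smul_mul, Matrix.mul_one]
    ext i j
    obtain rfl := Subsingleton.elim i 0
    obtain rfl := Subsingleton.elim j 0
    have h4 : (c * cᴴ) 0 0 = (c * cᴴ).trace := by simp [trace]
    simp only [Matrix.add_apply, Matrix.smul_apply, smul_eq_mul, h4, of_apply]
    linear_combination h2 - h1 + (B * ρ * B).trace * h3
  · rw [hT, Matrix.mul_smul, smul_mul, Matrix.mul_one]
    exact h ρ

lemma exists_conjTranspose_mul_self_eq [DecidableEq n] {P : Matrix n n ℂ} (hP : P.PosSemidef) :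
    ∃ C : Matrix n n ℂ, Cᴴ * C = P := by
  refine ⟨CFC.sqrt P, ?_⟩
  rw [(nonneg_iff_posSemidef.1 (CFC.sqrt_nonneg P)).1.eq, CFC.sqrt_mul_sqrt_self P hP.nonneg]

lemma isUnit_of_mul_conjTranspose_sub_posSemidef [DecidableEq n] {A : Matrix n n ℂ}
    (h : (A * Aᴴ - (1/2 : ℂ) • 1).PosSemidef) : IsUnit A := by
  have h1 : ((1/2 : ℂ) • (1 : Matrix n n ℂ)).PosDef := PosDef.one.smul (by norm_num)
  have h2 := (PosDef.posSemidef_add h h1).isUnit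
  rw [sub_add_cancel] at h2
  exact isUnit_of_mul_isUnit_left h2

lemma two_sub_inv_mul_posSemidef [DecidableEq n] {A : Matrix n n ℂ}
    (h : (A * Aᴴ - (1/2 : ℂ) • 1).PosSemidef) :
    ((2 : ℂ) • 1 - A⁻¹ᴴ * A⁻¹).PosSemidef := by
  have hA := isUnit_of_mul_conjTranspose_sub_posSemidef h
  have hd : IsUnit A.det := (isUnit_iff_isUnit_det A).1 hA
  have hd' : IsUnit Aᴴ.det := by rw [det_conjTranspose]; exact hd.star
  set Q := A * Aᴴ - (1/2 : ℂ) • 1 with hQ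
  have hN : A * Aᴴ = Q + (1/2 : ℂ) • 1 := by rw [hQ, sub_add_cancel]
  have hinv : A⁻¹ᴴ * A⁻¹ = (A * Aᴴ)⁻¹ := by rw [Matrix.mul_inv_rev, conjTranspose_nonsing_inv]
  have hNd : IsUnit (A * Aᴴ).det := by rw [det_mul]; exact hd.mul hd'
  have hNH : (A * Aᴴ)⁻¹ᴴ = (A * Aᴴ)⁻¹ := by
    rw [conjTranspose_nonsing_inv, conjTranspose_mul, conjTranspose_conjTranspose]
  have key : (2 : ℂ) • 1 - A⁻¹ᴴ * A⁻¹
      = (A * Aᴴ)⁻¹ᴴ * ((2 : ℂ) • (Qᴴ * Q) + Q) * (A * Aᴴ)⁻¹ := by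
    have h2 : (2 : ℂ) • (Qᴴ * Q) + Q = (A * Aᴴ) * ((2 : ℂ) • (A * Aᴴ) - 1) := by
      rw [h.1.eq, hN]
      simp only [mul_sub, mul_add, add_mul, smul_add, Matrix.mul_smul, smul_mul, mul_one, one_mul]
      module
    rw [h2, hNH, ← mul_assoc, nonsing_inv_mul _ hNd, one_mul, sub_mul, one_mul, smul_mul,
      mul_nonsing_inv _ hNd, hinv]
  rw [key]
  exact (((posSemidef_conjTranspose_mul_self Q).smul
    (by norm_num)).add h).conjTranspose_mul_mul_same _

end ErasureChannel

/-- the generalized erasure channel Γ of Λ(ρ) = AρAᴴ is degradable iff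
AAᴴ ≥ (1/2)·I or I − AᴴA has rank 1. -/
theorem gec_degradable_iff (d : ℕ) (A : Matrix (Fin d) (Fin d) ℂ)
    (hA : (1 - Aᴴ * A).PosSemidef) :
    (∃ (M : ℕ) (Km : Fin M → Matrix (Fin 1 ⊕ Fin d) (Fin d ⊕ Fin 1) ℂ),
      ∑ m, (Km m)ᴴ * Km m = 1 ∧
      ∀ ρ : Matrix (Fin d) (Fin d) ℂ,
        ∑ m, Km m * (Matrix.fromBlocks (A * ρ * Aᴴ) 0 0
            (Matrix.of fun (_ _ : Fin 1) => (CFC.sqrt (1 - Aᴴ * A) * ρ * CFC.sqrt (1 - Aᴴ * A)).trace)) * (Km m)ᴴ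
          = Matrix.fromBlocks (Matrix.of fun _ _ => (A * ρ * Aᴴ).trace) 0 0
              (CFC.sqrt (1 - Aᴴ * A) * ρ * CFC.sqrt (1 - Aᴴ * A)))
    ↔ ((A * Aᴴ - (1/2 : ℂ) • 1).PosSemidef ∨ (1 - Aᴴ * A).rank = 1) := by
  have hB : (CFC.sqrt (1 - Aᴴ * A)).PosSemidef := nonneg_iff_posSemidef.1 (CFC.sqrt_nonneg _)
  have hBB := CFC.sqrt_mul_sqrt_self (1 - Aᴴ * A) hA.nonneg
  set B := CFC.sqrt (1 - Aᴴ * A)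
  constructor
  · rintro ⟨M, K, hK, hdeg⟩
    by_contra! ⟨hpos, hrank⟩
    obtain ⟨v, μ, hv0, hμ, hv⟩ := exists_conjTranspose_mul_mulVec_eq_smul (A := A) (r := 1/2)
      (by simpa using hpos)
    have hb : 0 < √(1 - μ) := Real.sqrt_pos.2 (by linarith)
    have hb2 : ((√(1 - μ) : ℝ) : ℂ) * (√(1 - μ) : ℝ) = 1 - μ := by
      rw [← Complex.ofReal_mul, Real.mul_self_sqrt (by linarith)]
      simp
    have hGv : (1 - Aᴴ * A) *ᵥ v = (1 - μ : ℂ) • v := by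
      rw [sub_mulVec, one_mulVec, hv, sub_smul, one_smul]
    have hBv := mulVec_eq_smul_of_mul_self_mulVec hB hb (v := v) (by rw [hBB, hb2, hGv])
    have hvv : 0 < star v ⬝ᵥ v := dotProduct_star_self_pos_iff.2 hv0
    obtain ⟨w, hvw, hw⟩ : ∃ w, star v ⬝ᵥ w = 0 ∧ (1 - Aᴴ * A) *ᵥ w ≠ 0 := by
      by_contra! hcon
      refine hrank (rank_eq_one_of_mulVec_eq_zero (v := v) ?_ hcon)
      rw [hGv, ← hb2]
      simp [hb.ne', hv0]
    have hBw : B *ᵥ w ≠ 0 := fun h0 => hw (by rw [← hBB, ← mulVec_mulVec, h0, mulVec_zero])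
    have hle := mul_star_le_of_degrading hB.1 hK hdeg (v := v) (w := w) (by
      rw [dotProduct_mulVec, ← hB.1.eq, ← star_mulVec, hBv, star_smul, smul_dotProduct, hvw,
        smul_zero]) hBw
    rw [star_mulVec, ← dotProduct_mulVec, mulVec_mulVec, hv, hBv] at hle
    simp only [dotProduct_smul, smul_eq_mul, star_mul'] at hle
    have hstar : star (star v ⬝ᵥ v) = star v ⬝ᵥ v := by
      rw [← star_dotProduct_star, star_star, dotProduct_comm]
    rw [hstar, Complex.star_def, Complex.conj_ofReal, mul_mul_mul_comm, hb2,
      mul_left_comm (star v ⬝ᵥ v)] at hle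
    have h1 := le_of_mul_le_mul_right hle (mul_pos hvv hvv)
    have h2 : 1 - μ ≤ μ := by exact_mod_cast h1
    linarith
  · rintro (h | h)
    · have hA' := isUnit_of_mul_conjTranspose_sub_posSemidef h
      have hd := (isUnit_iff_isUnit_det A).1 hA'
      obtain ⟨C, hC⟩ := exists_conjTranspose_mul_self_eq (two_sub_inv_mul_posSemidef h)
      have hAi : A⁻¹ᴴ * Aᴴ = 1 := by
        rw [← conjTranspose_mul, mul_nonsing_inv _ hd, conjTranspose_one]
      have hAi' : Aᴴ * A⁻¹ᴴ = 1 := by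
        rw [← conjTranspose_mul, nonsing_inv_mul _ hd, conjTranspose_one]
      refine exists_degrading (C := C) (L := B * A⁻¹) (c := 1) (a := 0) ?_ (by simp) fun ρ => ?_
      · rw [hC, conjTranspose_mul, hB.1.eq, mul_assoc, ← mul_assoc B, hBB, sub_mul, one_mul,
          mul_assoc, mul_nonsing_inv _ hd, mul_one, mul_sub, hAi, two_smul]
        abel
      · calc
          _ = B * (A⁻¹ * A) * ρ * (Aᴴ * A⁻¹ᴴ) * B := by
            simp [conjTranspose_mul, hB.1.eq, mul_assoc]
          _ = _ := by rw [nonsing_inv_mul _ hd, hAi', mul_one, mul_one]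
    · rw [← hBB] at h
      nth_rw 1 [← hB.1.eq] at h
      rw [rank_conjTranspose_mul_self] at h
      obtain ⟨a, c, hac⟩ := exists_eq_vecMulVec_of_rank_eq_one h
      have ha : a ≠ 0 := by
        rintro rfl
        simp [hac] at h
      have hs : 0 < star a ⬝ᵥ a := dotProduct_star_self_pos_iff.2 ha
      have hB' (ρ : Matrix (Fin d) (Fin d) ℂ) :
          B * ρ * B = (c ⬝ᵥ ρ *ᵥ star c) • vecMulVec a (star a) := by
        nth_rw 2 [← hB.1.eq]
        rw [hac, conjTranspose_vecMulVec, mul_vecMulVec, ← mulVec_mulVec, vecMulVec_mulVec,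
          op_smul_eq_smul, smul_vecMulVec]
      obtain ⟨r, hr⟩ : ∃ r : ℂ, r * star r * (star a ⬝ᵥ a) = 1 := by
        have hre : star a ⬝ᵥ a = ((star a ⬝ᵥ a).re : ℂ) := Complex.eq_re_of_ofReal_le hs.le
        rw [hre] at hs ⊢
        have hs' : 0 < (star a ⬝ᵥ a).re := by exact_mod_cast hs
        refine ⟨((√(star a ⬝ᵥ a).re)⁻¹ : ℝ), ?_⟩
        rw [Complex.star_def, Complex.conj_ofReal, ← Complex.ofReal_mul, ← mul_inv,
          Real.mul_self_sqrt hs'.le, ← Complex.ofReal_mul, inv_mul_cancel₀ hs'.ne',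
          Complex.ofReal_one]
      have haa : replicateCol (Fin 1) (r • a) * (replicateCol (Fin 1) (r • a))ᴴ
          = (r * star r) • vecMulVec a (star a) := by
        ext i j
        simp [mul_apply, vecMulVec_apply]
        ring
      refine exists_degrading (C := 1) (L := 0) (c := 0) (a := replicateCol (Fin 1) (r • a))
        (by simp) ?_ fun ρ => ?_
      · ext i j
        obtain rfl := Subsingleton.elim i j
        rw [one_apply_eq, ← hr]
        simp only [conjTranspose_zero, mul_zero, zero_add, mul_apply, dotProduct, Finset.mul_sum,
          conjTranspose_apply, replicateCol_apply, Pi.smul_apply, Pi.star_apply, smul_eq_mul,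
          star_mul']
        exact Finset.sum_congr rfl fun _ _ => by ring
      · rw [haa, hB', trace_smul, trace_vecMulVec, dotProduct_comm a, smul_smul, smul_eq_mul]
        simp only [zero_mul, zero_add]
        congr 1
        linear_combination (c ⬝ᵥ ρ *ᵥ star c) * hr
end

section
/- Let A be a d×d complex matrix with AᴴA ≤ I, let B = √(I − AᴴA), and let Γ(ρ) = diag-blocks(AρAᴴ, tr(BρB)) and Γ̃(ρ) = diag-blocks(tr(AρAᴴ), BρB) be the generalized erasure channel of Λ(ρ) = AρAᴴ and its complementary channel, both mapping d×d matrices to (d+1)×(d+1) matrices. Then the following are equivalent: (i) there exist finitely many (d+1)×(d+1) matrices K_1,…,K_M with Σ_m K_mᴴ K_m = I such that Σ_m K_m Γ̃(ρ) K_mᴴ = Γ(ρ) for every d×d matrix ρ (i.e., Γ is antidegradable); (ii) AᴴA ≤ (1/2)·I in the Loewner order, or the matrix AᴴA has rank 1. -/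
open Matrix ComplexOrder MatrixOrder

lemma sum_fromBlocks_zero_zero_zero {ι m n p q : Type*} [Fintype ι] (f : ι → Matrix m n ℂ) :
    ∑ i, (fromBlocks 0 0 0 (f i) : Matrix (p ⊕ m) (q ⊕ n) ℂ) = fromBlocks 0 0 0 (∑ i, f i) := by
  ext (i | i) (j | j) <;> simp [Matrix.sum_apply]

/-- If `uᴴu + sᴴs = 1` and `CᴴC + DᴴD = 1`, the block map sending `x ⊕ σ` to
`(u x uᴴ + C σ Cᴴ) ⊕ (s x sᴴ + tr (D σ Dᴴ))` has a Kraus representation. -/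
lemma exists_kraus_of_blocks {d : ℕ} (u : Matrix (Fin d) (Fin 1) ℂ) (s : Matrix (Fin 1) (Fin 1) ℂ)
    (C D : Matrix (Fin d) (Fin d) ℂ) (hus : uᴴ * u + sᴴ * s = 1) (hCD : Cᴴ * C + Dᴴ * D = 1) :
    ∃ (M : ℕ) (Km : Fin M → Matrix (Fin d ⊕ Fin 1) (Fin 1 ⊕ Fin d) ℂ),
      ∑ m, (Km m)ᴴ * Km m = 1 ∧
      ∀ (x : Matrix (Fin 1) (Fin 1) ℂ) (σ : Matrix (Fin d) (Fin d) ℂ),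
        ∑ m, Km m * fromBlocks x 0 0 σ * (Km m)ᴴ
          = fromBlocks (u * x * uᴴ + C * σ * Cᴴ) 0 0
              (s * x * sᴴ + Matrix.of fun _ _ => (D * σ * Dᴴ).trace) := by
  let R : Fin d → Matrix (Fin 1) (Fin d) ℂ := fun i => Matrix.of fun _ j => D i j
  have hR : ∑ i, (R i)ᴴ * R i = Dᴴ * D := by
    ext i j
    simp [R, Matrix.sum_apply, Matrix.mul_apply]
  have hRσ (σ : Matrix (Fin d) (Fin d) ℂ) :
      ∑ i, R i * σ * (R i)ᴴ = Matrix.of fun _ _ => (D * σ * Dᴴ).trace := by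
    ext i j
    simp [R, Matrix.sum_apply, Matrix.mul_apply, Matrix.trace]
  refine ⟨d + 3, Fin.cons (fromBlocks u 0 0 0) (Fin.cons (fromBlocks 0 C 0 0)
    (Fin.cons (fromBlocks 0 0 s 0) fun i => fromBlocks 0 0 0 (R i))), ?_, fun x σ => ?_⟩
  · simp only [Fin.sum_univ_succ, Fin.cons_zero, Fin.cons_succ, fromBlocks_conjTranspose,
      fromBlocks_multiply, conjTranspose_zero, Matrix.mul_zero, Matrix.zero_mul, add_zero, zero_add]
    rw [sum_fromBlocks_zero_zero_zero, hR]
    simp only [fromBlocks_add, add_zero, zero_add]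
    rw [hus, hCD, fromBlocks_one]
  · simp only [Fin.sum_univ_succ, Fin.cons_zero, Fin.cons_succ, fromBlocks_conjTranspose,
      fromBlocks_multiply, conjTranspose_zero, Matrix.mul_zero, Matrix.zero_mul, add_zero, zero_add]
    rw [sum_fromBlocks_zero_zero_zero, hRσ]
    simp only [fromBlocks_add, add_zero, zero_add]

/-- A rank one matrix is a unit column times a row. -/
lemma exists_unit_col_mul_row_of_rank_eq_one {d : ℕ} {A : Matrix (Fin d) (Fin d) ℂ}
    (h : A.rank = 1) :
    ∃ (u : Matrix (Fin d) (Fin 1) ℂ) (w : Matrix (Fin 1) (Fin d) ℂ), uᴴ * u = 1 ∧ A = u * w := by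
  obtain ⟨t, ht0, ht⟩ := finrank_eq_one_iff'.1 h
  have ht0' : (t : Fin d → ℂ) ≠ 0 := by simpa using ht0
  choose c hc using fun j => ht ⟨A *ᵥ Pi.single j 1, LinearMap.mem_range_self A.mulVecLin _⟩
  have hpos : 0 < (star (t : Fin d → ℂ) ⬝ᵥ t) := dotProduct_star_self_pos_iff.2 ht0'
  obtain ⟨r, hr, hrt⟩ : ∃ r : ℝ, 0 < r ∧ (r : ℂ) * r = star (t : Fin d → ℂ) ⬝ᵥ t := by
    obtain ⟨h1, h2⟩ := Complex.pos_iff.1 hpos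
    refine ⟨√(star (t : Fin d → ℂ) ⬝ᵥ t).re, Real.sqrt_pos.2 h1, ?_⟩
    rw [← Complex.ofReal_mul, Real.mul_self_sqrt h1.le]
    exact Complex.ext rfl (by simpa using h2)
  have hr' : (r : ℂ) ≠ 0 := by exact_mod_cast hr.ne'
  refine ⟨Matrix.of fun i _ => (r : ℂ)⁻¹ * (t : Fin d → ℂ) i, Matrix.of fun _ j => r * c j, ?_, ?_⟩
  · ext i j
    have : ∑ x, (r : ℂ)⁻¹ * star ((t : Fin d → ℂ) x) * ((r : ℂ)⁻¹ * (t : Fin d → ℂ) x) = 1 := by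
      calc _ = (r : ℂ)⁻¹ * (r : ℂ)⁻¹ * (star (t : Fin d → ℂ) ⬝ᵥ t) := by
            rw [dotProduct, Finset.mul_sum]
            exact Finset.sum_congr rfl fun x _ => by simp only [Pi.star_apply]; ring
        _ = 1 := by rw [← hrt]; field_simp
    simpa [Matrix.mul_apply, Matrix.one_apply, Subsingleton.elim i j] using this
  · ext i j
    have := congrFun (congrArg Subtype.val (hc j)) i
    simp at this
    simp [Matrix.mul_apply, ← this]
    field_simp

/-- The common image `T` of the flag `|0⟩⟨0|` under the degrading map is a state, and it is
dominated by the output of the channel on every input. -/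
lemma exists_flag_state {d M : ℕ} (A B : Matrix (Fin d) (Fin d) ℂ) (hB : B.IsHermitian)
    (Km : Fin M → Matrix (Fin d ⊕ Fin 1) (Fin 1 ⊕ Fin d) ℂ)
    (h1 : ∑ m, (Km m)ᴴ * Km m = 1)
    (h2 : ∀ ρ : Matrix (Fin d) (Fin d) ℂ,
        ∑ m, Km m * (Matrix.fromBlocks (Matrix.of fun _ _ => (A * ρ * Aᴴ).trace) 0 0
            (B * ρ * B) : Matrix (Fin 1 ⊕ Fin d) (Fin 1 ⊕ Fin d) ℂ) * (Km m)ᴴ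
          = Matrix.fromBlocks (A * ρ * Aᴴ) 0 0 (Matrix.of fun _ _ => (B * ρ * B).trace)) :
    ∃ T : Matrix (Fin d ⊕ Fin 1) (Fin d ⊕ Fin 1) ℂ, T.PosSemidef ∧ T.trace = 1 ∧
      ∀ ρ : Matrix (Fin d) (Fin d) ℂ, ρ.PosSemidef →
        (Matrix.fromBlocks (A * ρ * Aᴴ) 0 0 (Matrix.of fun _ _ => (B * ρ * B).trace)
          - (A * ρ * Aᴴ).trace • T).PosSemidef := by
  let E : Matrix (Fin 1 ⊕ Fin d) (Fin 1 ⊕ Fin d) ℂ := fromBlocks 1 0 0 0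
  have hE : E.PosSemidef := by
    have : E = Eᴴ * E := by simp [E, fromBlocks_conjTranspose, fromBlocks_multiply]
    rw [this]
    exact posSemidef_conjTranspose_mul_self E
  refine ⟨∑ m : Fin M, (Km m * E * (Km m)ᴴ : Matrix (Fin d ⊕ Fin 1) (Fin d ⊕ Fin 1) ℂ),
    posSemidef_sum _ fun m _ => hE.mul_mul_conjTranspose_same (Km m), ?_, fun ρ hρ => ?_⟩
  · calc (∑ m, Km m * E * (Km m)ᴴ).trace = (E * ∑ m, (Km m)ᴴ * Km m).trace := by
          rw [trace_sum, Matrix.mul_sum, trace_sum]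
          refine Finset.sum_congr rfl fun m _ => ?_
          rw [Matrix.mul_assoc, trace_mul_comm, Matrix.mul_assoc]
      _ = 1 := by simp [h1, E, Matrix.trace]
  · have hσ : (B * ρ * B).PosSemidef := by
      simpa [hB.eq] using hρ.mul_mul_conjTranspose_same B
    have hF : (fromBlocks 0 0 0 (B * ρ * B) :
        Matrix (Fin 1 ⊕ Fin d) (Fin 1 ⊕ Fin d) ℂ).PosSemidef := by
      have := hσ.conjTranspose_mul_mul_same (fromCols 0 1 : Matrix (Fin d) (Fin 1 ⊕ Fin d) ℂ)
      convert this using 1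
      ext (i | i) (j | j) <;> simp [Matrix.mul_apply, Matrix.one_apply]
    have key : Matrix.fromBlocks (A * ρ * Aᴴ) 0 0 (Matrix.of fun _ _ => (B * ρ * B).trace)
          - (A * ρ * Aᴴ).trace • ∑ m, Km m * E * (Km m)ᴴ
        = ∑ m, Km m * (fromBlocks 0 0 0 (B * ρ * B) : Matrix (Fin 1 ⊕ Fin d) (Fin 1 ⊕ Fin d) ℂ)
            * (Km m)ᴴ := by
      rw [← h2, Finset.smul_sum, ← Finset.sum_sub_distrib]
      refine Finset.sum_congr rfl fun m _ => ?_
      rw [← Matrix.smul_mul, ← Matrix.mul_smul, ← Matrix.sub_mul, ← Matrix.mul_sub]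
      congr 2
      ext (i | i) (j | j) <;> simp [E, Matrix.one_apply, eq_iff_true_of_subsingleton]
    rw [key]
    exact posSemidef_sum _ fun m _ => hF.mul_mul_conjTranspose_same _

/-- If `S` is dominated, up to a scalar, by the rank one matrix of `a ≠ 0`, then the range of `S`
lies on the line through `a`. -/
lemma mulVec_mem_span_of_le_vecMulVec {d : ℕ} {S : Matrix (Fin d) (Fin d) ℂ} (hS : S.PosSemidef)
    {a : Fin d → ℂ} (ha : a ≠ 0)
    (h : (vecMulVec a (star a) - (star a ⬝ᵥ a) • S).PosSemidef) (x : Fin d → ℂ) :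
    ∃ c : ℂ, S *ᵥ x = c • a := by
  have hpos : 0 < star a ⬝ᵥ a := dotProduct_star_self_pos_iff.2 ha
  have horth : ∀ y : Fin d → ℂ, star a ⬝ᵥ y = 0 → S *ᵥ y = 0 := by
    intro y hy
    rw [← hS.dotProduct_mulVec_zero_iff]
    have h1 := h.dotProduct_mulVec_nonneg y
    rw [sub_mulVec, smul_mulVec, vecMulVec_mulVec, hy] at h1
    simp only [MulOpposite.op_zero, zero_smul, zero_sub, dotProduct_neg, dotProduct_smul,
      smul_eq_mul, Left.nonneg_neg_iff] at h1
    have h2 := hS.dotProduct_mulVec_nonneg y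
    have h3 := le_antisymm h1 (mul_nonneg hpos.le h2)
    exact (mul_eq_zero.1 h3).resolve_left hpos.ne'
  refine ⟨(star a ⬝ᵥ (S *ᵥ x)) / (star a ⬝ᵥ a), sub_eq_zero.1 ?_⟩
  set c := (star a ⬝ᵥ (S *ᵥ x)) / (star a ⬝ᵥ a) with hc
  set y := S *ᵥ x - c • a with hy
  have hay : star a ⬝ᵥ y = 0 := by
    rw [hy, dotProduct_sub, dotProduct_smul, hc, smul_eq_mul, div_mul_cancel₀ _ hpos.ne', sub_self]
  have hya : star y ⬝ᵥ a = 0 := by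
    have := congrArg star hay
    rwa [star_dotProduct, star_star, star_zero] at this
  have hyS : star y ⬝ᵥ (S *ᵥ x) = 0 := by
    rw [dotProduct_mulVec]
    have : star y ᵥ* S = star (S *ᵥ y) := by rw [star_mulVec, hS.isHermitian.eq]
    rw [this, horth y hay, star_zero, zero_dotProduct]
  have hyy : star y ⬝ᵥ y = 0 := by
    nth_rewrite 2 [hy]
    rw [dotProduct_sub, hyS, dotProduct_smul, hya, smul_zero, sub_zero]
  exact dotProduct_star_self_eq_zero.1 hyy

/-- the generalized erasure channel Γ of Λ(ρ) = AρAᴴ is antidegradable iff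
AᴴA ≤ (1/2)·I or AᴴA has rank 1. -/
theorem gec_antidegradable_iff (d : ℕ) (A : Matrix (Fin d) (Fin d) ℂ)
    (hA : (1 - Aᴴ * A).PosSemidef) :
    (∃ (M : ℕ) (Km : Fin M → Matrix (Fin d ⊕ Fin 1) (Fin 1 ⊕ Fin d) ℂ),
      ∑ m, (Km m)ᴴ * Km m = 1 ∧
      ∀ ρ : Matrix (Fin d) (Fin d) ℂ,
        ∑ m, Km m * (Matrix.fromBlocks (Matrix.of fun _ _ => (A * ρ * Aᴴ).trace) 0 0
            (CFC.sqrt (1 - Aᴴ * A) * ρ * CFC.sqrt (1 - Aᴴ * A)) :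
              Matrix (Fin 1 ⊕ Fin d) (Fin 1 ⊕ Fin d) ℂ) * (Km m)ᴴ
          = Matrix.fromBlocks (A * ρ * Aᴴ) 0 0
              (Matrix.of fun _ _ => (CFC.sqrt (1 - Aᴴ * A) * ρ * CFC.sqrt (1 - Aᴴ * A)).trace))
    ↔ (((1/2 : ℂ) • 1 - Aᴴ * A).PosSemidef ∨ (Aᴴ * A).rank = 1) := by
  have hBB : CFC.sqrt (1 - Aᴴ * A) * CFC.sqrt (1 - Aᴴ * A) = 1 - Aᴴ * A :=
    CFC.sqrt_mul_sqrt_self _ (Matrix.nonneg_iff_posSemidef.2 hA)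
  have hB : (CFC.sqrt (1 - Aᴴ * A)).IsHermitian :=
    (Matrix.nonneg_iff_posSemidef.1 (CFC.sqrt_nonneg (1 - Aᴴ * A))).isHermitian
  generalize CFC.sqrt (1 - Aᴴ * A) = B at hBB hB ⊢
  rw [rank_conjTranspose_mul_self]
  constructor
  · rintro ⟨M, Km, h1, h2⟩
    obtain ⟨T, hT, hT1, hle⟩ := exists_flag_state A B hB Km h1 h2
    have hS : T.toBlocks₁₁.PosSemidef := hT.submatrix Sum.inl
    have hrho (v : Fin d → ℂ) : A * vecMulVec v (star v) * Aᴴ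
        = vecMulVec (A *ᵥ v) (star (A *ᵥ v)) := by
      rw [mul_vecMulVec, vecMulVec_mul, star_mulVec]
    have htr (v : Fin d → ℂ) : (A * vecMulVec v (star v) * Aᴴ).trace
        = star (A *ᵥ v) ⬝ᵥ (A *ᵥ v) := by
      rw [hrho, trace_vecMulVec, dotProduct_comm]
    by_cases hS0 : T.toBlocks₁₁ = 0
    · left
      have hTb : T (Sum.inr 0) (Sum.inr 0) = 1 := by
        have h3 : T.toBlocks₁₁.trace + T (Sum.inr 0) (Sum.inr 0) = 1 := by
          rw [← hT1]; simp [Matrix.trace, toBlocks₁₁]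
        simpa [hS0] using h3
      refine PosSemidef.of_dotProduct_mulVec_nonneg ?_ fun v => ?_
      · refine IsHermitian.sub ?_ (isHermitian_conjTranspose_mul_self A)
        simp [IsHermitian, conjTranspose_smul]
      · have h3 := (hle _ (posSemidef_vecMulVec_self_star v)).diag_nonneg (i := Sum.inr 0)
        have h4 : (B * vecMulVec v (star v) * B).trace
            = star v ⬝ᵥ v - star (A *ᵥ v) ⬝ᵥ (A *ᵥ v) := by
          rw [Matrix.trace_mul_comm, ← Matrix.mul_assoc, hBB, mul_vecMulVec, trace_vecMulVec,
            dotProduct_comm, sub_mulVec, one_mulVec, dotProduct_sub, ← mulVec_mulVec,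
            dotProduct_mulVec, ← star_mulVec]
        rw [htr] at h3
        simp only [Matrix.sub_apply, fromBlocks_apply₂₂, of_apply, Matrix.smul_apply,
          hTb, h4, smul_eq_mul, mul_one] at h3
        rw [sub_mulVec, smul_mulVec, one_mulVec, dotProduct_sub, ← mulVec_mulVec,
            dotProduct_mulVec _ Aᴴ, ← star_mulVec, dotProduct_smul, smul_eq_mul]
        have h5 : (0 : ℂ) ≤ 1 / 2 := by
          rw [Complex.nonneg_iff]; norm_num
        convert mul_nonneg h5 h3 using 1
        ring
    · by_cases hA0 : A = 0
      · left
        rw [hA0, Matrix.mul_zero, sub_zero]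
        refine PosSemidef.one.smul ?_
        rw [Complex.nonneg_iff]; norm_num
      · right
        obtain ⟨x, hx⟩ : ∃ x, T.toBlocks₁₁ *ᵥ x ≠ 0 := by
          by_contra! hcon
          exact hS0 (Matrix.ext_of_mulVec_single fun i => by rw [hcon, zero_mulVec])
        have hrange : LinearMap.range A.mulVecLin ≤ Submodule.span ℂ {T.toBlocks₁₁ *ᵥ x} := by
          rintro _ ⟨v, rfl⟩
          rw [Submodule.mem_span_singleton, mulVecLin_apply]
          by_cases hv : A *ᵥ v = 0
          · exact ⟨0, by rw [hv, zero_smul]⟩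
          have h3 := (hle _ (posSemidef_vecMulVec_self_star v)).submatrix Sum.inl
          rw [htr, hrho] at h3
          obtain ⟨c, hc⟩ := mulVec_mem_span_of_le_vecMulVec hS hv h3 x
          have hc0 : c ≠ 0 := by
            rintro rfl
            exact hx (by rw [hc, zero_smul])
          exact ⟨c⁻¹, by rw [hc, inv_smul_smul₀ hc0]⟩
        refine le_antisymm ?_ (Nat.one_le_iff_ne_zero.2 fun h => hA0 ?_)
        · exact (Submodule.finrank_mono hrange).trans_eq (finrank_span_singleton hx)
        · have h0 := LinearMap.range_eq_bot.1 (Submodule.finrank_eq_zero.1 h)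
          exact Matrix.ext_of_mulVec_single fun i => by
            rw [← mulVecLin_apply, h0, LinearMap.zero_apply, zero_mulVec]
  · rintro (hhalf | hrank)
    · have hpd : (B * B).PosDef := by
        have h3 : B * B = (1 / 2 : ℂ) • 1 + ((1 / 2 : ℂ) • 1 - Aᴴ * A) := by
          rw [hBB, ← add_sub_assoc, ← add_smul]; norm_num
        rw [h3]
        refine (PosDef.one.smul ?_).add_posSemidef hhalf
        rw [Complex.pos_iff]; norm_num
      have hu : IsUnit B.det := by
        have := (Matrix.isUnit_iff_isUnit_det _).1 hpd.isUnit
        rw [det_mul] at this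
        exact isUnit_of_mul_isUnit_left this
      have hBi : B⁻¹ᴴ = B⁻¹ := hB.inv.eq
      have hCC : 1 - (A * B⁻¹)ᴴ * (A * B⁻¹)
          = B⁻¹ᴴ * ((2 : ℂ) • ((1 / 2 : ℂ) • 1 - Aᴴ * A)) * B⁻¹ := by
        have h3 : (2 : ℂ) • ((1 / 2 : ℂ) • 1 - Aᴴ * A) = B * B - Aᴴ * A := by
          rw [hBB, smul_sub, smul_smul, two_smul]; norm_num; abel
        rw [h3, conjTranspose_mul, hBi, Matrix.mul_sub, Matrix.sub_mul,
          nonsing_inv_mul_cancel_left _ _ hu, mul_nonsing_inv _ hu]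
        simp only [Matrix.mul_assoc]
      have hpsd : (1 - (A * B⁻¹)ᴴ * (A * B⁻¹)).PosSemidef := by
        rw [hCC]
        refine (hhalf.smul ?_).conjTranspose_mul_mul_same _
        rw [Complex.nonneg_iff]; norm_num
      obtain ⟨D, hD⟩ :=
        CStarAlgebra.nonneg_iff_eq_star_mul_self.1 (Matrix.nonneg_iff_posSemidef.2 hpsd)
      rw [star_eq_conjTranspose] at hD
      obtain ⟨M, Km, h1, h2⟩ := exists_kraus_of_blocks (0 : Matrix (Fin d) (Fin 1) ℂ) 1 (A * B⁻¹) D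
        (by simp) (by rw [← hD]; abel)
      refine ⟨M, Km, h1, fun ρ => ?_⟩
      rw [h2]
      congr 1
      · rw [Matrix.zero_mul, Matrix.zero_mul, zero_add, conjTranspose_mul, hBi]
        simp only [Matrix.mul_assoc, nonsing_inv_mul_cancel_left _ _ hu,
          mul_nonsing_inv_cancel_left _ _ hu]
      · have h3 : (D * (B * ρ * B) * Dᴴ).trace
            = (B * ρ * B).trace - (A * ρ * Aᴴ).trace := by
          rw [Matrix.trace_mul_comm, ← Matrix.mul_assoc, ← hD, Matrix.sub_mul, trace_sub,
            Matrix.one_mul, conjTranspose_mul, hBi]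
          congr 1
          simp only [Matrix.mul_assoc, nonsing_inv_mul_cancel_left _ _ hu]
          rw [Matrix.trace_mul_comm]
          simp only [Matrix.mul_assoc, mul_nonsing_inv _ hu, Matrix.mul_one]
          rw [Matrix.trace_mul_comm, Matrix.mul_assoc]
        ext i j
        simp [h3]
    · obtain ⟨u, w, hu, rfl⟩ := exists_unit_col_mul_row_of_rank_eq_one hrank
      obtain ⟨M, Km, h1, h2⟩ := exists_kraus_of_blocks u 0 (0 : Matrix (Fin d) (Fin d) ℂ) 1
        (by simp [hu]) (by simp)
      refine ⟨M, Km, h1, fun ρ => ?_⟩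
      rw [h2]
      congr 1
      · have h3 : (Matrix.of fun _ _ => (u * w * ρ * (u * w)ᴴ).trace : Matrix (Fin 1) (Fin 1) ℂ)
            = w * ρ * wᴴ := by
          have : (u * w * ρ * (u * w)ᴴ).trace = (w * ρ * wᴴ).trace := by
            rw [conjTranspose_mul, ← Matrix.mul_assoc, Matrix.trace_mul_comm]
            simp only [← Matrix.mul_assoc, hu, Matrix.one_mul]
          ext i j
          rw [of_apply, this, trace_fin_one, Subsingleton.elim i 0, Subsingleton.elim j 0]
        rw [h3, conjTranspose_mul]
        simp [Matrix.mul_assoc]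
      · simp
end
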